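/- arXiv:1007.1311 — 2 statements merged into one kernel-verified Lean document; each statement's English description precedes it below -/
import Mathlib

section
/- Let Y be an open subset of ℝ^d (d ≥ 2), x ∈ Y, and μ a compactly supported (in Y) finite Borel measure on Y such that ∫ u dμ ≤ u(x) for every continuous function u : Y → ℝ that is superharmonic on Y. Then the same inequality ∫ u dμ ≤ u(x) holds for every superharmonic function u on Y (i.e. lower semicontinuous, not identically +∞ on any component, satisfying the super-mean-value inequality), the integral of the negative part of u being finite. -/
open MeasureTheory Metric

/-- A superharmonic function on an open set `U ⊆ ℝ^d`: lower semicontinuous with values in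
`(-∞, ∞]`, not identically `+∞` on any connected component of `U`, and satisfying the
super-mean-value inequality (expressed via averages of the truncations `u ⊓ n`, which are
bounded measurable on compact balls). -/
def SuperharmonicOn {d : ℕ} (u : EuclideanSpace ℝ (Fin d) → EReal)
    (U : Set (EuclideanSpace ℝ (Fin d))) : Prop :=
  LowerSemicontinuousOn u U ∧ (∀ x ∈ U, ⊥ < u x) ∧
  (∀ x ∈ U, ∃ y ∈ connectedComponentIn U x, u y ≠ ⊤) ∧
  ∀ x ∈ U, ∀ r > (0 : ℝ), closedBall x r ⊆ U → ∀ n : ℕ,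
    ((⨍ y in closedBall x r, ((u y) ⊓ (n : EReal)).toReal ∂volume : ℝ) : EReal) ≤ u x

section Calculus

open Set Filter Topology

lemma lipschitzWith_one_sub_min_norm_sq {E : Type*} [SeminormedAddCommGroup E] :
    LipschitzWith 2 (fun h : E => 1 - (min ‖h‖ 1) ^ 2) := by
  refine LipschitzWith.of_dist_le_mul fun a b => ?_
  have h1 : |min ‖a‖ 1 - min ‖b‖ 1| ≤ ‖a - b‖ :=
    (abs_min_sub_min_le_max _ _ _ _).trans (by simpa using abs_norm_sub_norm_le a b)
  have ha : 0 ≤ min ‖a‖ 1 := by positivity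
  have hb : 0 ≤ min ‖b‖ 1 := by positivity
  have ha' : min ‖a‖ 1 ≤ 1 := min_le_right _ _
  have hb' : min ‖b‖ 1 ≤ 1 := min_le_right _ _
  rw [Real.dist_eq, dist_eq_norm]
  have : 1 - min ‖a‖ 1 ^ 2 - (1 - min ‖b‖ 1 ^ 2)
      = -((min ‖a‖ 1 - min ‖b‖ 1) * (min ‖a‖ 1 + min ‖b‖ 1)) := by ring
  rw [this, abs_neg, abs_mul, abs_of_nonneg (add_nonneg ha hb)]
  have h2 : min ‖a‖ 1 + min ‖b‖ 1 ≤ 2 := by linarith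
  calc _ ≤ ‖a - b‖ * 2 := mul_le_mul h1 h2 (by positivity) (norm_nonneg _)
    _ = _ := by simp [mul_comm]

lemma lineDeriv_one_sub_min_norm_sq {E : Type*} [NormedAddCommGroup E] [InnerProductSpace ℝ E]
    {h : E} (hh : ‖h‖ ≠ 1) (v : E) :
    lineDeriv ℝ (fun h : E => 1 - (min ‖h‖ 1) ^ 2) h (-v)
      = (closedBall (0 : E) 1).indicator (fun h => 2 * inner ℝ h v) h := by
  rcases lt_or_gt_of_ne hh with h1 | h1
  · have e : (fun h : E => 1 - (min ‖h‖ 1) ^ 2) =ᶠ[𝓝 h] fun h => 1 - ‖h‖ ^ 2 := by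
      filter_upwards [continuous_norm.continuousAt.eventually_lt continuousAt_const h1] with w hw
      rw [min_eq_left hw.le]
    rw [e.lineDeriv_eq, indicator_of_mem (by simpa using h1.le)]
    have := ((hasStrictFDerivAt_norm_sq h).hasFDerivAt.const_sub 1).hasLineDerivAt (-v)
    rw [this.lineDeriv]
    simp
  · have e : (fun h : E => 1 - (min ‖h‖ 1) ^ 2) =ᶠ[𝓝 h] fun h => 0 := by
      filter_upwards [continuousAt_const.eventually_lt continuous_norm.continuousAt h1] with w hw
      rw [min_eq_right hw.le]; norm_num
    rw [e.lineDeriv_eq, indicator_of_notMem (by simpa using h1)]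
    simp [lineDeriv]

variable {d : ℕ}

/-- Integrating by parts on the unit ball turns the radial derivative of `f` into its Laplacian. -/
lemma setIntegral_fderiv_radial_nonneg [NeZero d] {f : EuclideanSpace ℝ (Fin d) → ℝ}
    (hf : ContDiff ℝ 2 f) (hc : HasCompactSupport f) (y : EuclideanSpace ℝ (Fin d)) {t : ℝ}
    (ht : 0 ≤ t)
    (hL : ∀ w ∈ closedBall y t, 0 ≤ ∑ i, fderiv ℝ
      (fun w => fderiv ℝ f w (EuclideanSpace.single i 1)) w (EuclideanSpace.single i 1)) :
    0 ≤ ∫ h in closedBall (0 : EuclideanSpace ℝ (Fin d)) 1, fderiv ℝ f (y + t • h) h := by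
  set e : Fin d → EuclideanSpace ℝ (Fin d) := fun i => EuclideanSpace.single i 1
  set g : EuclideanSpace ℝ (Fin d) → ℝ := fun h => 1 - (min ‖h‖ 1) ^ 2 with hg
  have hgl : LipschitzWith 2 g := lipschitzWith_one_sub_min_norm_sq
  have hgz : ∀ h, h ∉ closedBall (0 : EuclideanSpace ℝ (Fin d)) 1 → g h = 0 := by
    intro h hh
    have : 1 < ‖h‖ := by simpa using hh
    simp [hg, min_eq_right this.le]
  have hgc : HasCompactSupport g :=
    HasCompactSupport.of_support_subset_isCompact (isCompact_closedBall 0 1)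
      (fun h hh => by by_contra h'; exact hh (hgz h h'))
  have hg0 : ∀ h, 0 ≤ g h := fun h => by
    have h1 : min ‖h‖ 1 ≤ 1 := min_le_right _ _
    have h2 : 0 ≤ min ‖h‖ 1 := by positivity
    simp only [hg]; nlinarith
  have hD : ∀ i, ContDiff ℝ 1 (fun w => fderiv ℝ f w (e i)) := fun i =>
    (hf.fderiv_right (m := 1) (by norm_num)).clm_apply contDiff_const
  have hDc : ∀ i, HasCompactSupport (fun w => fderiv ℝ f w (e i)) := fun i =>
    hc.fderiv_apply ℝ (e i)
  set P : Fin d → EuclideanSpace ℝ (Fin d) → ℝ := fun i h => fderiv ℝ f (y + t • h) (e i)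
  set Q : Fin d → EuclideanSpace ℝ (Fin d) → ℝ := fun i w =>
    fderiv ℝ (fun w => fderiv ℝ f w (e i)) w (e i)
  have hQc : ∀ i, Continuous (Q i) := fun i =>
    ((hD i).continuous_fderiv (by norm_num)).clm_apply continuous_const
  have hPc : ∀ i, Continuous (P i) := fun i => (hD i).continuous.comp (by fun_prop)
  have key : ∀ i, ∫ h, t * Q i (y + t • h) * g h
      = ∫ h in closedBall (0 : EuclideanSpace ℝ (Fin d)) 1, 2 * (inner ℝ h (e i) * P i h) := by
    intro i
    obtain ⟨C, hC⟩ := (hD i).lipschitzWith_of_hasCompactSupport (hDc i) (by norm_num)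
    have hA : LipschitzWith (‖t‖₊) (fun h : EuclideanSpace ℝ (Fin d) => y + t • h) :=
      LipschitzWith.of_dist_le_mul fun a b => by simp [dist_smul₀]
    have h1 := LipschitzWith.integral_lineDeriv_mul_eq (μ := volume) (hC.comp hA) hgl hgc (e i)
    have h2 : ∀ h, lineDeriv ℝ ((fun w => fderiv ℝ f w (e i)) ∘ fun h => y + t • h) h (e i)
        = t * Q i (y + t • h) := by
      intro h
      have hB : HasFDerivAt (fun h : EuclideanSpace ℝ (Fin d) => y + t • h)
          (t • ContinuousLinearMap.id ℝ _) h := ((hasFDerivAt_id h).const_smul t).const_add y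
      have := (((hD i).differentiable (by norm_num) (y + t • h)).hasFDerivAt.comp h
        hB).hasLineDerivAt (e i)
      rw [this.lineDeriv]
      simp [Q]
    simp_rw [h2] at h1
    rw [h1, ← integral_indicator measurableSet_closedBall]
    refine integral_congr_ae ?_
    have hs : ∀ᵐ h : EuclideanSpace ℝ (Fin d), h ∉ sphere (0 : EuclideanSpace ℝ (Fin d)) 1 :=
      measure_eq_zero_iff_ae_notMem.1 (Measure.addHaar_sphere _ _ _)
    filter_upwards [hs] with h hh
    rw [lineDeriv_one_sub_min_norm_sq (by simpa using hh)]
    by_cases h' : h ∈ closedBall (0 : EuclideanSpace ℝ (Fin d)) 1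
    · simp only [indicator_of_mem h']; simp [P, mul_assoc]
    · simp only [indicator_of_notMem h']; simp
  have h3 : ∀ h, fderiv ℝ f (y + t • h) h = ∑ i, inner ℝ h (e i) * P i h := by
    intro h
    have h' : fderiv ℝ f (y + t • h) h = fderiv ℝ f (y + t • h) (∑ i, h i • e i) := by
      congr 1
      simpa [e] using ((EuclideanSpace.basisFun (Fin d) ℝ).sum_repr h).symm
    rw [h', map_sum]
    refine Finset.sum_congr rfl fun i _ => ?_
    simp [P, e, EuclideanSpace.inner_single_right]
  have h4 : 2 * ∫ h in closedBall (0 : EuclideanSpace ℝ (Fin d)) 1, fderiv ℝ f (y + t • h) h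
      = ∫ h, t * (∑ i, Q i (y + t • h)) * g h := by
    rw [← integral_const_mul]
    simp_rw [h3, Finset.mul_sum, Finset.sum_mul]
    rw [integral_finsetSum, integral_finsetSum]
    · exact Finset.sum_congr rfl fun i _ => (key i).symm
    · intro i _
      have : Continuous fun h => t * Q i (y + t • h) * g h := by
        have := hQc i; have := hgl.continuous; fun_prop
      exact this.integrable_of_hasCompactSupport (hgc.mul_left)
    · intro i _
      have : Continuous fun h => 2 * (inner ℝ h (e i) * P i h) := by
        have := hPc i; fun_prop
      exact this.continuousOn.integrableOn_compact (isCompact_closedBall _ _)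
  have h5 : 0 ≤ ∫ h, t * (∑ i, Q i (y + t • h)) * g h := by
    refine integral_nonneg fun h => ?_
    by_cases h' : h ∈ closedBall (0 : EuclideanSpace ℝ (Fin d)) 1
    · refine mul_nonneg (mul_nonneg ht (hL _ ?_)) (hg0 h)
      have h1 : ‖h‖ ≤ 1 := by simpa using h'
      simp only [mem_closedBall, dist_self_add_left, norm_smul, Real.norm_eq_abs, abs_of_nonneg ht]
      nlinarith
    · simp [hgz h h']
  linarith

lemma setAverage_closedBall_eq (f : EuclideanSpace ℝ (Fin d) → ℝ)
    (y : EuclideanSpace ℝ (Fin d)) {r : ℝ} (hr : 0 < r) :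
    ⨍ w in closedBall y r, f w = ⨍ h in closedBall (0 : EuclideanSpace ℝ (Fin d)) 1,
      f (y + r • h) := by
  have h1 : ∫ h in closedBall (0 : EuclideanSpace ℝ (Fin d)) 1, f (y + r • h)
      = (r ^ d)⁻¹ * ∫ w in closedBall y r, f w := by
    have h2 := Measure.setIntegral_comp_smul_of_pos (volume : Measure (EuclideanSpace ℝ (Fin d)))
      (fun w => f (y + w)) (closedBall 0 1) hr
    rw [h2, smul_unitClosedBall_of_nonneg hr.le, finrank_euclideanSpace_fin, smul_eq_mul]
    congr 1
    have h3 := (measurePreserving_add_left volume y).setIntegral_preimage_emb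
      (measurableEmbedding_addLeft y) f (closedBall y r)
    rw [← h3, preimage_add_closedBall]; simp
  have h4 : volume.real (closedBall y r)
      = r ^ d * volume.real (closedBall (0 : EuclideanSpace ℝ (Fin d)) 1) := by
    rw [Measure.real, Measure.addHaar_closedBall' _ _ hr.le, finrank_euclideanSpace_fin,
      ENNReal.toReal_mul, ENNReal.toReal_ofReal (by positivity)]
    rfl
  rw [setAverage_eq, setAverage_eq, h1, h4, smul_eq_mul, smul_eq_mul, mul_inv]
  ring

/-- A function whose Laplacian is nonnegative on a ball is at most its mean over that ball. -/
lemma le_setAverage_closedBall_of_laplacian_nonneg [NeZero d] {f : EuclideanSpace ℝ (Fin d) → ℝ}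
    (hf : ContDiff ℝ 2 f) (hc : HasCompactSupport f) (y : EuclideanSpace ℝ (Fin d)) {r : ℝ}
    (hr : 0 < r)
    (hL : ∀ w ∈ closedBall y r, 0 ≤ ∑ i, fderiv ℝ
      (fun w => fderiv ℝ f w (EuclideanSpace.single i 1)) w (EuclideanSpace.single i 1)) :
    f y ≤ ⨍ w in closedBall y r, f w := by
  set B := closedBall (0 : EuclideanSpace ℝ (Fin d)) 1
  have hfc := hf.continuous
  have hf'c : Continuous (fderiv ℝ f) := hf.continuous_fderiv (by norm_num)
  obtain ⟨C, hC⟩ := (hc.fderiv ℝ).exists_bound_of_continuous hf'c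
  have hder : ∀ t : ℝ, HasDerivAt (fun t : ℝ => ∫ h in B, f (y + t • h))
      (∫ h in B, fderiv ℝ f (y + t • h) h) t := by
    intro t
    refine (hasDerivAt_integral_of_dominated_loc_of_deriv_le (bound := fun _ => C)
      (s := univ) (F' := fun t h => fderiv ℝ f (y + t • h) h) univ_mem ?_ ?_ ?_ ?_ ?_ ?_).2
    · exact Eventually.of_forall fun t => Continuous.aestronglyMeasurable (by fun_prop)
    · exact (Continuous.continuousOn (by fun_prop)).integrableOn_compact (isCompact_closedBall _ _)
    · exact Continuous.aestronglyMeasurable (by fun_prop)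
    · filter_upwards [ae_restrict_mem measurableSet_closedBall] with h hh t _
      have h1 : ‖h‖ ≤ 1 := by simpa [B] using hh
      have h0 : 0 ≤ C := (norm_nonneg _).trans (hC 0)
      calc _ ≤ ‖fderiv ℝ f (y + t • h)‖ * ‖h‖ := ContinuousLinearMap.le_opNorm _ _
        _ ≤ C * 1 := mul_le_mul (hC _) h1 (norm_nonneg _) h0
        _ = C := mul_one C
    · exact continuousOn_const.integrableOn_compact (isCompact_closedBall _ _)
    · refine Eventually.of_forall fun h t _ => ?_
      have h1 : HasDerivAt (fun t : ℝ => y + t • h) h t := by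
        simpa using ((hasDerivAt_id t).smul_const h).const_add y
      exact (hf.differentiable (by norm_num) _).hasFDerivAt.comp_hasDerivAt t h1
  have hmono : MonotoneOn (fun t : ℝ => ∫ h in B, f (y + t • h)) (Icc 0 r) := by
    refine monotoneOn_of_deriv_nonneg (convex_Icc 0 r)
      (fun t _ => (hder t).continuousAt.continuousWithinAt)
      (fun t _ => (hder t).differentiableAt.differentiableWithinAt) fun t ht => ?_
    rw [interior_Icc] at ht
    rw [(hder t).deriv]
    exact setIntegral_fderiv_radial_nonneg hf hc y ht.1.le
      fun w hw => hL w (closedBall_subset_closedBall ht.2.le hw)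
  have h1 := hmono ⟨le_rfl, hr.le⟩ ⟨hr.le, le_rfl⟩ hr.le
  have hB : 0 < volume.real B :=
    ENNReal.toReal_pos (measure_closedBall_pos _ _ one_pos).ne' measure_closedBall_lt_top.ne
  rw [setAverage_closedBall_eq f y hr, setAverage_eq, smul_eq_mul]
  simp only [zero_smul, add_zero, setIntegral_const, smul_eq_mul] at h1
  rw [inv_mul_eq_div, le_div_iff₀ hB]
  linarith

end Calculus

section Exhaustion

open Set Filter Topology

variable {d : ℕ}

lemma le_setAverage_closedBall_of_contDiffAt [NeZero d] {f : EuclideanSpace ℝ (Fin d) → ℝ}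
    {y : EuclideanSpace ℝ (Fin d)} {r r' : ℝ} (hr : 0 < r) (hrr' : r < r')
    (hf : ∀ w ∈ closedBall y r', ContDiffAt ℝ 2 f w)
    (hL : ∀ w ∈ closedBall y r, 0 ≤ ∑ i, fderiv ℝ
      (fun w => fderiv ℝ f w (EuclideanSpace.single i 1)) w (EuclideanSpace.single i 1)) :
    f y ≤ ⨍ w in closedBall y r, f w := by
  let χ : ContDiffBump y := ⟨(r + r') / 2, r', by linarith, by linarith⟩
  set F : EuclideanSpace ℝ (Fin d) → ℝ := fun w => χ w * f w
  have hχ : ∀ w ∈ ball y ((r + r') / 2), F =ᶠ[𝓝 w] f := by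
    intro w hw
    filter_upwards [isOpen_ball.mem_nhds hw] with v hv
    simp [F, χ.one_of_mem_closedBall (ball_subset_closedBall hv)]
  have hsub : closedBall y r ⊆ ball y ((r + r') / 2) := closedBall_subset_ball (by linarith)
  have hF : ContDiff ℝ 2 F := by
    rw [contDiff_iff_contDiffAt]
    intro w
    by_cases hw : w ∈ closedBall y r'
    · exact χ.contDiff.contDiffAt.mul (hf w hw)
    · have : F =ᶠ[𝓝 w] fun _ => 0 := by
        filter_upwards [isClosed_closedBall.isOpen_compl.mem_nhds hw] with v hv
        have : r' ≤ dist v y := by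
          have : r' < dist v y := by simpa using hv
          exact this.le
        simp [F, χ.zero_of_le_dist this]
      exact contDiffAt_const.congr_of_eventuallyEq this
  have hFc : HasCompactSupport F := χ.hasCompactSupport.mul_right
  have h := le_setAverage_closedBall_of_laplacian_nonneg hF hFc y hr ?_
  · rw [(hχ y (hsub (mem_closedBall_self hr.le))).eq_of_nhds] at h
    rwa [setAverage_congr_fun measurableSet_closedBall
      (Eventually.of_forall fun w hw => (hχ w (hsub hw)).eq_of_nhds)] at h
  · intro w hw
    refine (hL w hw).trans_eq (Finset.sum_congr rfl fun i _ => ?_)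
    have : (fun w => fderiv ℝ F w (EuclideanSpace.single i (1 : ℝ))) =ᶠ[𝓝 w]
        fun w => fderiv ℝ f w (EuclideanSpace.single i (1 : ℝ)) := by
      filter_upwards [(hχ w (hsub hw)).fderiv (𝕜 := ℝ)] with v hv
      rw [hv]
    rw [this.fderiv_eq]

lemma hasFDerivAt_norm_sub_sq_zpow (z : EuclideanSpace ℝ (Fin d)) (m : ℤ)
    {w : EuclideanSpace ℝ (Fin d)} (hw : w ≠ z) :
    HasFDerivAt (fun w : EuclideanSpace ℝ (Fin d) => (‖w - z‖ ^ 2) ^ m)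
      ((m * (‖w - z‖ ^ 2) ^ (m - 1)) • (2 • innerSL ℝ (w - z))) w := by
  have hq : ‖w - z‖ ^ 2 ≠ 0 := by
    have := sub_ne_zero.2 hw
    positivity
  have h1 : HasFDerivAt (fun w => ‖w - z‖ ^ 2) (2 • innerSL ℝ (w - z)) w :=
    ((hasFDerivAt_id w).sub_const z).norm_sq
  exact (hasDerivAt_zpow m _ (Or.inl hq)).comp_hasFDerivAt w h1

lemma norm_sub_sq_zpow_le_setAverage [NeZero d] {y z : EuclideanSpace ℝ (Fin d)} {r : ℝ}
    (hr : 0 < r) (hz : z ∉ closedBall y r) {m : ℤ} (hm : 0 ≤ m * (2 * (m - 1) + d)) :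
    (‖y - z‖ ^ 2) ^ m ≤ ⨍ w in closedBall y r, (‖w - z‖ ^ 2) ^ m := by
  have hz' : r < dist z y := by simpa using hz
  have hne : ∀ w ∈ closedBall y ((r + dist z y) / 2), w ≠ z := by
    rintro w hw rfl
    simp only [mem_closedBall] at hw
    linarith
  refine le_setAverage_closedBall_of_contDiffAt (f := fun w => (‖w - z‖ ^ 2) ^ m)
    (r' := (r + dist z y) / 2) hr (by linarith) (fun w hw => ?_) fun w hw => ?_
  · have hq : ‖w - z‖ ^ 2 ≠ 0 := by
      have := sub_ne_zero.2 (hne w hw)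
      positivity
    have h1 : ContDiffAt ℝ 2 (fun w => ‖w - z‖ ^ 2) w :=
      (contDiff_id.sub contDiff_const).norm_sq ℝ |>.contDiffAt
    exact ContDiffAt.comp (g := fun q : ℝ => q ^ m) w
      (by
        obtain ⟨k, rfl | rfl⟩ := m.eq_nat_or_neg
        · simpa using contDiffAt_id.pow k
        · simp only [zpow_neg, zpow_natCast]
          exact ContDiffAt.inv (contDiffAt_id.pow k) (pow_ne_zero k hq)) h1
  · have hw' : w ≠ z := hne w (closedBall_subset_closedBall (by linarith) hw)
    have hq : 0 < ‖w - z‖ ^ 2 := by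
      have := sub_ne_zero.2 hw'
      positivity
    have h2 : ∀ i : Fin d, fderiv ℝ (fun w => fderiv ℝ (fun w => (‖w - z‖ ^ 2) ^ m) w
        (EuclideanSpace.single i 1)) w (EuclideanSpace.single i 1)
        = 2 * m * (‖w - z‖ ^ 2) ^ (m - 1)
          + 4 * (m * (m - 1)) * (‖w - z‖ ^ 2) ^ (m - 2) * (w i - z i) ^ 2 := by
      intro i
      have e : (fun w => fderiv ℝ (fun w => (‖w - z‖ ^ 2) ^ m) w (EuclideanSpace.single i 1))
          =ᶠ[𝓝 w] fun w => (2 * m) *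
            ((‖w - z‖ ^ 2) ^ (m - 1) * inner ℝ (EuclideanSpace.single i (1 : ℝ)) (w - z)) := by
        filter_upwards [isOpen_ne.mem_nhds hw'] with v hv
        rw [(hasFDerivAt_norm_sub_sq_zpow z m hv).fderiv]
        simp [EuclideanSpace.inner_single_left, EuclideanSpace.inner_single_right]
        ring
      rw [e.fderiv_eq]
      have h3 : HasFDerivAt (fun w : EuclideanSpace ℝ (Fin d) =>
          inner ℝ (EuclideanSpace.single i (1 : ℝ)) (w - z))
          (innerSL ℝ (EuclideanSpace.single i (1 : ℝ))) w :=
        (innerSL ℝ (EuclideanSpace.single i (1 : ℝ))).hasFDerivAt.comp w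
          ((hasFDerivAt_id w).sub_const z)
      rw [(((hasFDerivAt_norm_sub_sq_zpow z (m - 1) hw').fun_mul h3).const_mul (2 * (m : ℝ))).fderiv]
      have h4 : m - 1 - 1 = m - 2 := by ring
      simp [EuclideanSpace.inner_single_left, EuclideanSpace.inner_single_right, h4]
      ring
    rw [Finset.sum_congr rfl fun i _ => h2 i, Finset.sum_add_distrib, Finset.sum_const,
      ← Finset.mul_sum]
    have h5 : ∑ i, (w i - z i) ^ 2 = ‖w - z‖ ^ 2 := by
      rw [EuclideanSpace.norm_sq_eq]; simp
    have h6 : (‖w - z‖ ^ 2) ^ (m - 1) = (‖w - z‖ ^ 2) ^ (m - 2) * ‖w - z‖ ^ 2 := by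
      rw [← zpow_add_one₀ hq.ne']; congr 1; ring
    rw [h5, h6]
    have h7 : (0 : ℝ) ≤ m * (2 * (m - 1) + d) := by exact_mod_cast hm
    have h8 : 0 < (‖w - z‖ ^ 2) ^ (m - 2) := zpow_pos hq _
    simp only [Finset.card_univ, Fintype.card_fin, nsmul_eq_mul]
    have := mul_nonneg h7 (mul_pos h8 hq).le
    nlinarith

/-- A continuous subharmonic exhaustion function of an open set `Y`. -/
noncomputable def subharmonicExhaustion (Y : Set (EuclideanSpace ℝ (Fin d)))
    (w : EuclideanSpace ℝ (Fin d)) : ℝ :=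
  ‖w‖ ^ 2 + (infDist w Yᶜ ^ 2) ^ (-(d : ℤ))

variable {Y : Set (EuclideanSpace ℝ (Fin d))}

lemma subharmonicExhaustion_nonneg (w : EuclideanSpace ℝ (Fin d)) :
    0 ≤ subharmonicExhaustion Y w := by
  unfold subharmonicExhaustion; positivity

lemma continuousOn_subharmonicExhaustion (hY : IsOpen Y) :
    ContinuousOn (subharmonicExhaustion Y) Y := by
  unfold subharmonicExhaustion
  refine ContinuousOn.add (by fun_prop) ?_
  rcases Yᶜ.eq_empty_or_nonempty with h | h
  · simp only [h, infDist_empty]; fun_prop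
  · refine ContinuousOn.zpow₀ (((continuous_infDist_pt _).pow 2).continuousOn) _ fun w hw => ?_
    have := (hY.isClosed_compl.notMem_iff_infDist_pos h).1 (by simpa using hw)
    exact Or.inl (pow_ne_zero 2 this.ne')

lemma norm_sq_le_setAverage [NeZero d] (y : EuclideanSpace ℝ (Fin d)) {r : ℝ} (hr : 0 < r) :
    ‖y‖ ^ 2 ≤ ⨍ w in closedBall y r, ‖w‖ ^ 2 := by
  refine le_setAverage_closedBall_of_contDiffAt (f := fun w => ‖w‖ ^ 2) (r' := r + 1) hr
    (by linarith) (fun w _ => (contDiff_norm_sq ℝ).contDiffAt) fun w _ => ?_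
  refine Finset.sum_nonneg fun i _ => ?_
  have h : (fun w => fderiv ℝ (fun w : EuclideanSpace ℝ (Fin d) => ‖w‖ ^ 2) w
      (EuclideanSpace.single i 1)) = fun w =>
        2 * innerSL ℝ (EuclideanSpace.single i (1 : ℝ)) w := by
    ext w
    rw [(hasStrictFDerivAt_norm_sq w).hasFDerivAt.fderiv]
    simp [EuclideanSpace.inner_single_left, EuclideanSpace.inner_single_right]
  rw [h, (((innerSL ℝ (EuclideanSpace.single i (1 : ℝ))).hasFDerivAt (x := w)).const_mul 2).fderiv]
  simp

lemma subharmonicExhaustion_le_setAverage [NeZero d] (hY : IsOpen Y)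
    {y : EuclideanSpace ℝ (Fin d)} {r : ℝ} (hr : 0 < r) (hB : closedBall y r ⊆ Y) :
    subharmonicExhaustion Y y ≤ ⨍ w in closedBall y r, subharmonicExhaustion Y w := by
  have hint : IntegrableOn (subharmonicExhaustion Y) (closedBall y r) :=
    ((continuousOn_subharmonicExhaustion hY).mono hB).integrableOn_compact
      (isCompact_closedBall _ _)
  have hnorm : IntegrableOn (fun w : EuclideanSpace ℝ (Fin d) => ‖w‖ ^ 2) (closedBall y r) :=
    (Continuous.continuousOn (by fun_prop)).integrableOn_compact (isCompact_closedBall _ _)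
  have hdist : IntegrableOn (fun w => (infDist w Yᶜ ^ 2) ^ (-(d : ℤ))) (closedBall y r) := by
    refine (hint.sub hnorm).congr_fun (fun w _ => ?_) measurableSet_closedBall
    simp [subharmonicExhaustion]
  have hsplit : ⨍ w in closedBall y r, subharmonicExhaustion Y w
      = (⨍ w in closedBall y r, ‖w‖ ^ 2)
        + ⨍ w in closedBall y r, (infDist w Yᶜ ^ 2) ^ (-(d : ℤ)) := by
    unfold subharmonicExhaustion
    rw [setAverage_eq, setAverage_eq, setAverage_eq, integral_add hnorm hdist, smul_add]
  rw [hsplit]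
  refine add_le_add (norm_sq_le_setAverage y hr) ?_
  rcases Yᶜ.eq_empty_or_nonempty with h | h
  · have hB0 : volume.real (closedBall y r) ≠ 0 :=
      (ENNReal.toReal_pos (measure_closedBall_pos _ _ hr).ne' measure_closedBall_lt_top.ne).ne'
    simp [h, NeZero.ne d]
  · obtain ⟨z, hz, hyz⟩ := hY.isClosed_compl.exists_infDist_eq_dist h y
    have hzB : z ∉ closedBall y r := fun h' => hz (hB h')
    have hd1 : 1 ≤ d := NeZero.one_le
    have h1 := norm_sub_sq_zpow_le_setAverage hr hzB (m := -(d : ℤ)) (by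
      have : (1 : ℤ) ≤ d := by exact_mod_cast hd1
      nlinarith)
    rw [hyz, dist_eq_norm]
    refine h1.trans ?_
    have hc : ContinuousOn (fun w => (‖w - z‖ ^ 2) ^ (-(d : ℤ))) (closedBall y r) := by
      refine ContinuousOn.zpow₀ (Continuous.continuousOn (by fun_prop)) _ fun w hw => ?_
      have : w - z ≠ 0 := sub_ne_zero.2 fun e => hzB (e ▸ hw)
      left; positivity
    rw [setAverage_eq, setAverage_eq, smul_eq_mul, smul_eq_mul]
    refine mul_le_mul_of_nonneg_left ?_ (by positivity)
    refine setIntegral_mono_on (hc.integrableOn_compact (isCompact_closedBall _ _)) hdist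
      measurableSet_closedBall fun w hw => ?_
    have hpos := (hY.isClosed_compl.notMem_iff_infDist_pos h).1 (by simpa using hB hw)
    have hle : infDist w Yᶜ ≤ ‖w - z‖ := dist_eq_norm w z ▸ infDist_le_dist_of_mem hz
    rw [zpow_neg, zpow_neg, zpow_natCast, zpow_natCast]
    gcongr

lemma pow_mul_subharmonicExhaustion_le_setAverage [NeZero d] (hY : IsOpen Y)
    {y w : EuclideanSpace ℝ (Fin d)} {r ρ : ℝ} (hρ : 0 < ρ) (hr : 0 < r)
    (hw : closedBall w ρ ⊆ closedBall y r) (hB : closedBall y r ⊆ Y) :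
    (ρ / r) ^ d * subharmonicExhaustion Y w
      ≤ ⨍ w in closedBall y r, subharmonicExhaustion Y w := by
  have h1 := subharmonicExhaustion_le_setAverage hY hρ (hw.trans hB)
  have hint : IntegrableOn (subharmonicExhaustion Y) (closedBall y r) :=
    ((continuousOn_subharmonicExhaustion hY).mono hB).integrableOn_compact
      (isCompact_closedBall _ _)
  have hvol : ∀ (a : EuclideanSpace ℝ (Fin d)) {t : ℝ}, 0 < t → volume.real (closedBall a t)
      = t ^ d * volume.real (ball (0 : EuclideanSpace ℝ (Fin d)) 1) := by
    intro a t ht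
    rw [Measure.real, Measure.addHaar_closedBall _ _ ht.le, finrank_euclideanSpace_fin,
      ENNReal.toReal_mul, ENNReal.toReal_ofReal (by positivity)]
    rfl
  have hV : 0 < volume.real (ball (0 : EuclideanSpace ℝ (Fin d)) 1) :=
    ENNReal.toReal_pos (measure_ball_pos _ _ one_pos).ne' measure_ball_lt_top.ne
  have h2 : ∫ v in closedBall w ρ, subharmonicExhaustion Y v
      ≤ ∫ v in closedBall y r, subharmonicExhaustion Y v :=
    setIntegral_mono_set hint (Eventually.of_forall fun v => subharmonicExhaustion_nonneg v)
      hw.eventuallyLE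
  rw [setAverage_eq, smul_eq_mul, hvol _ hρ] at h1
  rw [setAverage_eq, smul_eq_mul, hvol _ hr, div_pow]
  set V := volume.real (ball (0 : EuclideanSpace ℝ (Fin d)) 1)
  calc _ ≤ ρ ^ d / r ^ d * ((ρ ^ d * V)⁻¹ * ∫ v in closedBall y r, subharmonicExhaustion Y v) := by
        gcongr
        exact h1.trans (by gcongr)
    _ = _ := by field_simp

/-- Large balls, and balls coming close to the boundary of `Y`, have a large mean of the
exhaustion function. -/
lemma exists_compact_le_setAverage_subharmonicExhaustion [NeZero d] (hY : IsOpen Y) (c₀ : ℝ) :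
    ∃ L, IsCompact L ∧ L ⊆ Y ∧ (∀ w ∈ Y, w ∉ L → c₀ ≤ subharmonicExhaustion Y w) ∧
      ∀ y, subharmonicExhaustion Y y < c₀ → ∀ r > 0, closedBall y r ⊆ Y →
        ¬ closedBall y r ⊆ L →
        c₀ ≤ ⨍ w in closedBall y r, subharmonicExhaustion Y w := by
  obtain ⟨c, hc1, hcc⟩ : ∃ c : ℝ, 1 ≤ c ∧ c₀ ≤ c := ⟨max 1 c₀, le_max_left _ _, le_max_right _ _⟩
  have hd : d ≠ 0 := NeZero.ne d
  have hpow : ∀ a : ℝ, 0 < a → a ≤ c⁻¹ → c ≤ (a ^ d)⁻¹ := by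
    intro a ha hac
    have h1 : c ≤ a⁻¹ := (le_inv_comm₀ (by positivity) ha).2 hac
    calc c ≤ c ^ d := le_self_pow₀ hc1 hd
      _ ≤ (a⁻¹) ^ d := by gcongr
      _ = _ := inv_pow _ _
  set R : ℝ := 2 * c + 2 * (2 ^ d * c) with hR
  set η : ℝ := (4 * R * c)⁻¹ with hη
  have h2d : (1 : ℝ) ≤ 2 ^ d := one_le_pow₀ (by norm_num)
  have hR1 : 2 ≤ R := by nlinarith
  have hη0 : 0 < η := by positivity
  have hηc : η ≤ c⁻¹ / 8 := by
    rw [hη, div_eq_mul_inv, ← mul_inv]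
    exact inv_anti₀ (by positivity) (by nlinarith)
  have hci : c⁻¹ ≤ 1 := inv_le_one_of_one_le₀ hc1
  have hsq : ∀ w z, w ∈ Y → z ∉ Y → ∀ a : ℝ, dist w z ≤ a →
      ((a ^ 2) ^ d)⁻¹ ≤ subharmonicExhaustion Y w := by
    intro w z hw hz a haz
    have hpos := (hY.isClosed_compl.notMem_iff_infDist_pos ⟨z, hz⟩).1 (by simpa using hw)
    have hle : infDist w Yᶜ ≤ a := (infDist_le_dist_of_mem hz).trans haz
    unfold subharmonicExhaustion
    rw [zpow_neg, zpow_natCast]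
    have : ((a ^ 2) ^ d)⁻¹ ≤ ((infDist w Yᶜ ^ 2) ^ d)⁻¹ := by gcongr
    nlinarith [sq_nonneg ‖w‖]
  have hclose : ∀ w z, w ∈ Y → z ∉ Y → dist w z ≤ c⁻¹ → c ≤ subharmonicExhaustion Y w := by
    intro w z hw hz hwz
    refine (hpow (c⁻¹ ^ 2) (by positivity) ?_).trans (hsq w z hw hz _ hwz)
    nlinarith [inv_pos.2 (zero_lt_one.trans_le hc1)]
  refine ⟨closedBall 0 (c + R) ∩ ⋂ z ∈ Yᶜ, {w | η ≤ dist w z},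
    (isCompact_closedBall _ _).inter_right (isClosed_biInter fun z _ =>
      isClosed_le continuous_const (by fun_prop)), ?_, ?_, ?_⟩
  · rintro w ⟨-, hw⟩
    by_contra h
    have : η ≤ dist w w := by simpa using mem_iInter₂.1 hw w h
    rw [dist_self] at this
    linarith
  · intro w hw hwL
    refine hcc.trans ?_
    by_cases h : w ∈ closedBall (0 : EuclideanSpace ℝ (Fin d)) (c + R)
    · obtain ⟨z, hz, hwz⟩ : ∃ z, z ∉ Y ∧ dist w z < η := by
        by_contra! h'
        exact hwL ⟨h, mem_iInter₂.2 fun z hz => h' z hz⟩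
      exact hclose w z hw hz (by linarith [inv_pos.2 (zero_lt_one.trans_le hc1)])
    · have h1 : c + R < ‖w‖ := by simpa using h
      have h2 : 0 ≤ (infDist w Yᶜ ^ 2) ^ (-(d : ℤ)) := by positivity
      unfold subharmonicExhaustion
      nlinarith
  · intro y hy r hr hB hBL
    replace hy := hy.trans_le hcc
    refine hcc.trans ?_
    have hyY : y ∈ Y := hB (mem_closedBall_self hr.le)
    have hyc : ‖y‖ ≤ c := by
      have h2 : 0 ≤ (infDist y Yᶜ ^ 2) ^ (-(d : ℤ)) := by positivity
      unfold subharmonicExhaustion at hy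
      nlinarith [norm_nonneg y]
    rcases le_or_gt R r with hRr | hrR
    · obtain ⟨v, hv⟩ := exists_norm_eq (EuclideanSpace ℝ (Fin d)) (c := r / 2) (by positivity)
      refine le_trans ?_ (pow_mul_subharmonicExhaustion_le_setAverage (w := y + v) hY
        (half_pos hr) hr (closedBall_subset_closedBall' (by simp [hv])) hB)
      have h1 : 2 ^ d * c ≤ ‖y + v‖ := by
        have := norm_sub_le_norm_add v y
        rw [add_comm]; linarith
      have h2 : ‖y + v‖ ^ 2 ≤ subharmonicExhaustion Y (y + v) := by
        unfold subharmonicExhaustion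
        exact le_add_of_nonneg_right (by positivity)
      have h3 : r / 2 / r = 2⁻¹ := by field_simp
      have h4 : 1 ≤ 2 ^ d * c := by nlinarith
      rw [h3, inv_pow, inv_mul_eq_div, le_div_iff₀ (by positivity)]
      nlinarith
    · obtain ⟨w, hwB, hwL⟩ := not_subset.1 hBL
      have hwr : dist w y ≤ r := hwB
      obtain ⟨z, hz, hwz⟩ : ∃ z, z ∉ Y ∧ dist w z < η := by
        by_contra! h'
        refine hwL ⟨?_, mem_iInter₂.2 fun z hz => h' z hz⟩
        rw [mem_closedBall, dist_zero_right]
        have := norm_le_norm_add_norm_sub y w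
        rw [dist_eq_norm, norm_sub_rev] at hwr
        linarith
      have hyz : c⁻¹ < dist y z := by
        by_contra! h
        exact (hclose y z hyY hz h).not_gt hy
      have hyw : η < dist w y := by
        have := dist_triangle_left y z w
        linarith
      have hD : 0 < dist w y := hη0.trans hyw
      set v := w + (η / dist w y) • (y - w) with hv
      have hvw : dist v w = η := by
        rw [hv, dist_self_add_left, norm_smul, ← dist_eq_norm, dist_comm y w, Real.norm_eq_abs,
          abs_of_pos (by positivity)]
        field_simp
      have hvy : dist v y = dist w y - η := by
        have : v - y = (1 - η / dist w y) • (w - y) := by rw [hv]; module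
        rw [dist_eq_norm, this, norm_smul, ← dist_eq_norm w y, Real.norm_eq_abs, abs_of_nonneg]
        · field_simp
        · rw [sub_nonneg, div_le_one hD]; exact hyw.le
      have hsub : closedBall v η ⊆ closedBall y r := closedBall_subset_closedBall' (by linarith)
      refine le_trans ?_ (pow_mul_subharmonicExhaustion_le_setAverage (w := v) hY hη0 hr hsub hB)
      have h1 := hsq v z (hB (hsub (mem_closedBall_self hη0.le))) hz (2 * η)
        (by linarith [dist_triangle v w z])
      refine le_trans ?_ (mul_le_mul_of_nonneg_left h1 (by positivity))
      rw [← inv_pow, ← mul_pow, show η / r * ((2 * η) ^ 2)⁻¹ = (4 * r * η)⁻¹ by field_simp; norm_num,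
        inv_pow]
      refine hpow _ (by positivity) ?_
      calc 4 * r * η ≤ 4 * R * η := by gcongr
        _ = c⁻¹ := by rw [hη]; field_simp

end Exhaustion

section BallMeans

open Set Filter Topology

variable {d : ℕ}

lemma setAverage_mono_on {f g : EuclideanSpace ℝ (Fin d) → ℝ} {s : Set (EuclideanSpace ℝ (Fin d))}
    (hs : MeasurableSet s) (hf : IntegrableOn f s) (hg : IntegrableOn g s)
    (h : ∀ w ∈ s, f w ≤ g w) : ⨍ w in s, f w ≤ ⨍ w in s, g w := by
  rw [setAverage_eq, setAverage_eq, smul_eq_mul, smul_eq_mul]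
  exact mul_le_mul_of_nonneg_left (setIntegral_mono_on hf hg hs h) (by positivity)

lemma setAverage_closedBall_const (y : EuclideanSpace ℝ (Fin d)) {r : ℝ} (hr : 0 < r) (c : ℝ) :
    ⨍ _ in closedBall y r, c = c :=
  setAverage_const (measure_closedBall_pos _ _ hr).ne' measure_closedBall_lt_top.ne c

lemma setAverage_closedBall_add_right (g : EuclideanSpace ℝ (Fin d) → ℝ)
    (y h : EuclideanSpace ℝ (Fin d)) (r : ℝ) :
    ⨍ w in closedBall y r, g (w + h) = ⨍ w in closedBall (y + h) r, g w := by
  have h1 := (measurePreserving_add_right volume h).setIntegral_preimage_emb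
    (measurableEmbedding_addRight h) g (closedBall (y + h) r)
  rw [preimage_add_right_closedBall, add_sub_cancel_right] at h1
  rw [setAverage_eq, setAverage_eq, h1, Measure.real, Measure.real,
    Measure.addHaar_closedBall_center, Measure.addHaar_closedBall_center volume (y + h)]

variable {g : EuclideanSpace ℝ (Fin d) → ℝ} {a b : ℝ}

lemma integrableOn_closedBall_of_bounded (hg : Measurable g) (hgab : ∀ w, g w ∈ Icc a b)
    (y : EuclideanSpace ℝ (Fin d)) (r : ℝ) : IntegrableOn g (closedBall y r) :=
  have : IsFiniteMeasure (volume.restrict (closedBall y r)) :=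
    ⟨by simpa using measure_closedBall_lt_top⟩
  Integrable.of_mem_Icc a b hg.aemeasurable (Eventually.of_forall hgab)

lemma setAverage_closedBall_mem_Icc (hg : Measurable g) (hgab : ∀ w, g w ∈ Icc a b)
    (y : EuclideanSpace ℝ (Fin d)) {r : ℝ} (hr : 0 < r) :
    ⨍ w in closedBall y r, g w ∈ Icc a b := by
  have hi := integrableOn_closedBall_of_bounded hg hgab y r
  have hc : ∀ c : ℝ, IntegrableOn (fun _ => c) (closedBall y r) := fun c =>
    continuousOn_const.integrableOn_compact (isCompact_closedBall _ _)
  constructor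
  · rw [← setAverage_closedBall_const y hr a]
    exact setAverage_mono_on measurableSet_closedBall (hc a) hi fun w _ => (hgab w).1
  · rw [← setAverage_closedBall_const y hr b]
    exact setAverage_mono_on measurableSet_closedBall hi (hc b) fun w _ => (hgab w).2

lemma continuous_setAverage_closedBall [NeZero d] (hg : Measurable g) (hgab : ∀ w, g w ∈ Icc a b)
    (ε : ℝ) : Continuous fun w : EuclideanSpace ℝ (Fin d) => ⨍ t in closedBall w ε, g t := by
  have hvol : ∀ w : EuclideanSpace ℝ (Fin d), volume.real (closedBall w ε)
      = volume.real (closedBall (0 : EuclideanSpace ℝ (Fin d)) ε) := fun w => by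
    rw [Measure.real, Measure.addHaar_closedBall_center]; rfl
  simp_rw [setAverage_eq, hvol, smul_eq_mul]
  refine continuous_const.mul ?_
  simp_rw [← integral_indicator (measurableSet_closedBall)]
  rw [continuous_iff_continuousAt]
  intro w
  refine continuousAt_of_dominated
    (bound := (closedBall w (ε + 1)).indicator fun _ => max |a| |b|) ?_ ?_ ?_ ?_
  · exact Eventually.of_forall fun v =>
      (hg.indicator measurableSet_closedBall).aestronglyMeasurable
  · filter_upwards [ball_mem_nhds w one_pos] with v hv
    refine Eventually.of_forall fun t => ?_
    by_cases ht : t ∈ closedBall v ε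
    · have ht' : t ∈ closedBall w (ε + 1) := by
        have := dist_triangle t v w
        simp only [mem_closedBall, mem_ball] at *
        linarith
      rw [indicator_of_mem ht, indicator_of_mem ht', Real.norm_eq_abs]
      exact abs_le_max_abs_abs (hgab t).1 (hgab t).2
    · rw [indicator_of_notMem ht, norm_zero]
      exact indicator_nonneg (fun _ _ => by positivity) _
  · exact (integrable_indicator_iff measurableSet_closedBall).2
      (continuousOn_const.integrableOn_compact (isCompact_closedBall _ _))
  · have hs : ∀ᵐ t : EuclideanSpace ℝ (Fin d), t ∉ sphere w ε :=
      measure_eq_zero_iff_ae_notMem.1 (Measure.addHaar_sphere _ _ _)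
    filter_upwards [hs] with t ht
    have hc : Continuous fun v => dist t v := by fun_prop
    rcases lt_or_gt_of_ne (show dist t w ≠ ε from ht) with h | h
    · refine (continuousAt_const (y := g t)).congr ?_
      filter_upwards [hc.continuousAt.eventually_lt continuousAt_const h] with v hv
      rw [indicator_of_mem (mem_closedBall.2 hv.le)]
    · refine (continuousAt_const (y := (0 : ℝ))).congr ?_
      filter_upwards [continuousAt_const.eventually_lt hc.continuousAt h] with v hv
      rw [indicator_of_notMem (by simpa using hv)]

/-- Ball means inherit the super-mean-value inequality. -/
lemma setAverage_setAverage_le [NeZero d] (hg : Measurable g) (hgab : ∀ w, g w ∈ Icc a b)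
    {y : EuclideanSpace ℝ (Fin d)} {r ε : ℝ} (hr : 0 < r) (hε : 0 < ε)
    (hmean : ∀ v ∈ closedBall y ε, ⨍ t in closedBall v r, g t ≤ g v) :
    ⨍ w in closedBall y r, ⨍ t in closedBall w ε, g t ≤ ⨍ t in closedBall y ε, g t := by
  have hB : ∀ (v : EuclideanSpace ℝ (Fin d)) {t : ℝ}, 0 < t →
      IsProbabilityMeasure ((volume.restrict (closedBall v t) univ)⁻¹ •
        volume.restrict (closedBall v t)) := by
    intro v t ht
    have : IsFiniteMeasure (volume.restrict (closedBall v t)) :=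
      ⟨by simpa using measure_closedBall_lt_top⟩
    have : NeZero (volume.restrict (closedBall v t)) :=
      ⟨by simpa using (measure_closedBall_pos _ _ ht).ne'⟩
    infer_instance
  have := hB y hr
  have := hB 0 hε
  have hswap : ⨍ w in closedBall y r, ⨍ h in closedBall (0 : EuclideanSpace ℝ (Fin d)) ε, g (h + w)
      = ⨍ h in closedBall (0 : EuclideanSpace ℝ (Fin d)) ε, ⨍ w in closedBall y r, g (h + w) := by
    simp only [average]
    refine integral_integral_swap ?_
    exact Integrable.of_mem_Icc a b
      (hg.comp (measurable_snd.add measurable_fst)).aemeasurable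
      (Eventually.of_forall fun p => hgab _)
  simp_rw [setAverage_closedBall_add_right, zero_add] at hswap
  rw [hswap]
  have hinner : ∀ h, ⨍ w in closedBall y r, g (h + w) = ⨍ w in closedBall (y + h) r, g w := by
    intro h
    simp_rw [add_comm h]
    exact setAverage_closedBall_add_right g y h r
  have houter := setAverage_closedBall_add_right g 0 y ε
  rw [zero_add] at houter
  simp_rw [hinner]
  rw [← houter]
  have hcont : Continuous fun h => ⨍ w in closedBall (y + h) r, g w :=
    (continuous_setAverage_closedBall hg hgab r).comp (by fun_prop : Continuous fun h => y + h)
  refine setAverage_mono_on measurableSet_closedBall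
    (hcont.continuousOn.integrableOn_compact (isCompact_closedBall _ _))
    (integrableOn_closedBall_of_bounded (hg.comp (measurable_add_const y)) (fun _ => hgab _) _ _)
    fun h hh => ?_
  rw [add_comm h y]
  exact hmean _ (by simpa using hh)

lemma tendsto_setAverage_closedBall (hg : Measurable g) (hgab : ∀ w, g w ∈ Icc a b)
    {y : EuclideanSpace ℝ (Fin d)} {ε : ℕ → ℝ} (hε : ∀ k, 0 < ε k)
    (hε0 : Tendsto ε atTop (𝓝 0)) (hle : ∀ k, ⨍ t in closedBall y (ε k), g t ≤ g y)
    (hlsc : LowerSemicontinuousAt g y) :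
    Tendsto (fun k => ⨍ t in closedBall y (ε k), g t) atTop (𝓝 (g y)) := by
  refine tendsto_order.2 ⟨fun c hc => ?_, fun c hc => Eventually.of_forall fun k =>
    (hle k).trans_lt hc⟩
  obtain ⟨c', hcc', hc'⟩ := exists_between hc
  obtain ⟨δ, hδ, hball⟩ := Metric.eventually_nhds_iff_ball.1 (hlsc c' hc')
  filter_upwards [hε0.eventually_lt_const hδ] with k hk
  refine hcc'.trans_le ?_
  rw [← setAverage_closedBall_const y (hε k) c']
  exact setAverage_mono_on measurableSet_closedBall
    (continuousOn_const.integrableOn_compact (isCompact_closedBall _ _))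
    (integrableOn_closedBall_of_bounded hg hgab _ _)
    fun w hw => (hball w (closedBall_subset_ball hk hw)).le

end BallMeans

section Superharmonic

open Set Filter Topology

variable {d : ℕ} {Y : Set (EuclideanSpace ℝ (Fin d))}

lemma superharmonicOn_coe {v : EuclideanSpace ℝ (Fin d) → ℝ} (hv : ContinuousOn v Y)
    (hmean : ∀ y ∈ Y, ∀ r > 0, closedBall y r ⊆ Y → ⨍ w in closedBall y r, v w ≤ v y) :
    SuperharmonicOn (fun y => (v y : EReal)) Y := by
  refine ⟨(continuous_coe_real_ereal.comp_continuousOn hv).lowerSemicontinuousOn,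
    fun _ _ => EReal.bot_lt_coe _,
    fun y hy => ⟨y, mem_connectedComponentIn hy, EReal.coe_ne_top _⟩, fun y hy r hr hB n => ?_⟩
  have h1 : ∀ w, ((v w : EReal) ⊓ (n : EReal)).toReal = min (v w) n := fun w => by
    have h := EReal.coe_strictMono.monotone.map_min (a := v w) (b := (n : ℝ))
    rw [← EReal.coe_coe_eq_natCast, ← h, EReal.toReal_coe]
  simp_rw [h1]
  rw [EReal.coe_le_coe_iff]
  refine le_trans ?_ (hmean y hy r hr hB)
  have hvB := hv.mono hB
  exact setAverage_mono_on measurableSet_closedBall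
    ((hvB.inf continuousOn_const).integrableOn_compact (isCompact_closedBall _ _))
    (hvB.integrableOn_compact (isCompact_closedBall _ _)) fun w _ => min_le_left _ _

lemma SuperharmonicOn.exists_forall_neg_le {u : EuclideanSpace ℝ (Fin d) → EReal}
    (hu : SuperharmonicOn u Y) {K : Set (EuclideanSpace ℝ (Fin d))} (hK : IsCompact K)
    (hKY : K ⊆ Y) : ∃ m : ℝ, 0 ≤ m ∧ ∀ w ∈ K, ((-m : ℝ) : EReal) ≤ u w := by
  rcases K.eq_empty_or_nonempty with rfl | hne
  · exact ⟨0, le_rfl, by simp⟩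
  obtain ⟨a, ha, hmin⟩ := LowerSemicontinuousOn.exists_isMinOn hne hK (hu.1.mono hKY)
  obtain ⟨t, -, ht⟩ := EReal.lt_iff_exists_real_btwn.1 (hu.2.1 a (hKY ha))
  refine ⟨max 0 (-t), le_max_left _ _, fun w hw => ?_⟩
  refine le_trans ?_ (ht.le.trans (hmin hw))
  rw [EReal.coe_le_coe_iff]
  linarith [le_max_right 0 (-t)]

/-- The truncation `u ⊓ n`, as a real function, on `K`, extended by zero. -/
noncomputable def truncation (u : EuclideanSpace ℝ (Fin d) → EReal)
    (K : Set (EuclideanSpace ℝ (Fin d))) (n : ℕ) : EuclideanSpace ℝ (Fin d) → ℝ :=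
  K.indicator fun w => (u w ⊓ (n : EReal)).toReal

section Truncation

variable {u : EuclideanSpace ℝ (Fin d) → EReal} {K : Set (EuclideanSpace ℝ (Fin d))} (n : ℕ)

lemma SuperharmonicOn.coe_truncation (hu : SuperharmonicOn u Y) (hKY : K ⊆ Y)
    {w : EuclideanSpace ℝ (Fin d)} (hw : w ∈ K) :
    (truncation u K n w : EReal) = u w ⊓ (n : EReal) := by
  have hn : (n : EReal) < ⊤ := EReal.coe_lt_top n
  rw [truncation, indicator_of_mem hw, EReal.coe_toReal]
  · exact (inf_le_right.trans_lt hn).ne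
  · exact (lt_inf_iff.2 ⟨hu.2.1 w (hKY hw), bot_lt_iff_ne_bot.2 (EReal.natCast_ne_bot n)⟩).ne'

lemma SuperharmonicOn.measurable_truncation (hu : SuperharmonicOn u Y) (hK : IsClosed K)
    (hKY : K ⊆ Y) : Measurable (truncation u K n) := by
  refine measurable_of_restrict_of_restrict_compl hK.measurableSet ?_ ?_
  · have h1 : LowerSemicontinuous (K.domRestrict u) :=
      lowerSemicontinuous_restrict_iff.2 (hu.1.mono hKY)
    have h2 := (h1.measurable.inf (measurable_const (a := (n : EReal)))).ereal_toReal
    convert! h2 using 1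
    ext w
    simp [truncation, domRestrict]
  · convert! measurable_const (a := (0 : ℝ)) using 1
    ext w
    simp [truncation, show (w : EuclideanSpace ℝ (Fin d)) ∉ K from w.2]

lemma SuperharmonicOn.truncation_mem_Icc (hu : SuperharmonicOn u Y) (hKY : K ⊆ Y) {m : ℝ}
    (hm0 : 0 ≤ m) (hm : ∀ w ∈ K, ((-m : ℝ) : EReal) ≤ u w) (w : EuclideanSpace ℝ (Fin d)) :
    truncation u K n w ∈ Icc (-m) (n : ℝ) := by
  have hn : (0 : ℝ) ≤ n := n.cast_nonneg
  by_cases hw : w ∈ K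
  · have h := hu.coe_truncation n hKY hw
    constructor
    · rw [← EReal.coe_le_coe_iff, h, ← EReal.coe_coe_eq_natCast]
      exact le_inf (hm w hw) (EReal.coe_le_coe_iff.2 (by linarith))
    · rw [← EReal.coe_le_coe_iff, h, EReal.coe_coe_eq_natCast]
      exact inf_le_right
  · rw [truncation, indicator_of_notMem hw]
    exact ⟨by linarith, hn⟩

lemma SuperharmonicOn.setAverage_truncation_le (hu : SuperharmonicOn u Y) (hK : IsCompact K)
    (hKY : K ⊆ Y) {y : EuclideanSpace ℝ (Fin d)} {r : ℝ} (hr : 0 < r)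
    (hB : closedBall y r ⊆ K) : ⨍ w in closedBall y r, truncation u K n w ≤ truncation u K n y := by
  obtain ⟨m, hm0, hm⟩ := hu.exists_forall_neg_le hK hKY
  have hyK : y ∈ K := hB (mem_closedBall_self hr.le)
  rw [← EReal.coe_le_coe_iff, hu.coe_truncation n hKY hyK]
  refine le_inf ?_ ?_
  · have h := hu.2.2.2 y (hKY hyK) r hr (hB.trans hKY) n
    have hcongr : ⨍ w in closedBall y r, truncation u K n w
        = ⨍ w in closedBall y r, (u w ⊓ (n : EReal)).toReal :=
      setAverage_congr_fun measurableSet_closedBall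
        (Eventually.of_forall fun w hw => indicator_of_mem (hB hw) _)
    rwa [hcongr]
  · rw [← EReal.coe_coe_eq_natCast, EReal.coe_le_coe_iff]
    exact (setAverage_closedBall_mem_Icc (hu.measurable_truncation n hK.isClosed hKY)
      (hu.truncation_mem_Icc n hKY hm0 hm) y hr).2

lemma SuperharmonicOn.lowerSemicontinuousAt_truncation (hu : SuperharmonicOn u Y) (hKY : K ⊆ Y)
    {y : EuclideanSpace ℝ (Fin d)} (hy : K ∈ 𝓝 y) :
    LowerSemicontinuousAt (truncation u K n) y := by
  intro c hc
  have hyK := mem_of_mem_nhds hy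
  rw [gt_iff_lt, ← EReal.coe_lt_coe_iff, hu.coe_truncation n hKY hyK, lt_inf_iff] at hc
  have h := hu.1 y (hKY hyK) c hc.1
  rw [(nhdsWithin_eq_nhds.2 (mem_of_superset hy hKY))] at h
  filter_upwards [h, hy] with w hw hwK
  rw [gt_iff_lt, ← EReal.coe_lt_coe_iff, hu.coe_truncation n hKY hwK]
  exact lt_inf_iff.2 ⟨hw, hc.2⟩

end Truncation

end Superharmonic

section Barrier

open Set Filter Topology

variable {d : ℕ} {Y : Set (EuclideanSpace ℝ (Fin d))}

lemma setAverage_mul_const_sub {s : EuclideanSpace ℝ (Fin d) → ℝ} {y : EuclideanSpace ℝ (Fin d)}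
    {r : ℝ} (hr : 0 < r) (hs : IntegrableOn s (closedBall y r)) (A c : ℝ) :
    ⨍ w in closedBall y r, A * (c - s w) = A * (c - ⨍ w in closedBall y r, s w) := by
  have hc : IntegrableOn (fun _ => c) (closedBall y r) :=
    continuousOn_const.integrableOn_compact (isCompact_closedBall _ _)
  nth_rw 2 [← setAverage_closedBall_const y hr c]
  simp only [setAverage_eq, smul_eq_mul]
  rw [integral_const_mul, integral_sub hc hs]
  ring

/-- Cutting a ball mean off by a barrier built from the exhaustion gives a function satisfying the
super-mean-value inequality on every ball contained in `Y`, although the mean itself satisfies it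
only on balls contained in `L`. -/
lemma setAverage_min_barrier_le [NeZero d] (hY : IsOpen Y) {g : EuclideanSpace ℝ (Fin d) → ℝ}
    (hg : Measurable g) {A c ε : ℝ} (hA : 0 ≤ A) (hgA : ∀ w, g w ∈ Icc (-A) A) (hε : 0 < ε)
    {L : Set (EuclideanSpace ℝ (Fin d))}
    (hL : ∀ y, subharmonicExhaustion Y y < c + 2 → ∀ r > 0, closedBall y r ⊆ Y →
      ¬ closedBall y r ⊆ L → c + 2 ≤ ⨍ w in closedBall y r, subharmonicExhaustion Y w)
    (hmean : ∀ y, ∀ r > 0, closedBall y r ⊆ L →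
      ∀ v ∈ closedBall y ε, ⨍ t in closedBall v r, g t ≤ g v)
    {y : EuclideanSpace ℝ (Fin d)} {r : ℝ} (hr : 0 < r) (hB : closedBall y r ⊆ Y) :
    ⨍ w in closedBall y r,
        min (⨍ t in closedBall w ε, g t) (A * (c + 1 - subharmonicExhaustion Y w))
      ≤ min (⨍ t in closedBall y ε, g t) (A * (c + 1 - subharmonicExhaustion Y y)) := by
  have hs : ContinuousOn (subharmonicExhaustion Y) (closedBall y r) :=
    (continuousOn_subharmonicExhaustion hY).mono hB
  have hq : ContinuousOn (fun w => ⨍ t in closedBall w ε, g t) (closedBall y r) :=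
    (continuous_setAverage_closedBall hg hgA ε).continuousOn
  have hp : ContinuousOn (fun w => A * (c + 1 - subharmonicExhaustion Y w)) (closedBall y r) := by
    fun_prop
  have hcpt := isCompact_closedBall y r
  have hle_q : ⨍ w in closedBall y r,
      min (⨍ t in closedBall w ε, g t) (A * (c + 1 - subharmonicExhaustion Y w))
      ≤ ⨍ w in closedBall y r, ⨍ t in closedBall w ε, g t :=
    setAverage_mono_on measurableSet_closedBall ((hq.inf hp).integrableOn_compact hcpt)
      (hq.integrableOn_compact hcpt) fun _ _ => min_le_left _ _
  have hle_p : ⨍ w in closedBall y r,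
      min (⨍ t in closedBall w ε, g t) (A * (c + 1 - subharmonicExhaustion Y w))
      ≤ A * (c + 1 - ⨍ w in closedBall y r, subharmonicExhaustion Y w) := by
    rw [← setAverage_mul_const_sub hr (hs.integrableOn_compact hcpt)]
    exact setAverage_mono_on measurableSet_closedBall ((hq.inf hp).integrableOn_compact hcpt)
      (hp.integrableOn_compact hcpt) fun _ _ => min_le_right _ _
  rcases le_or_gt (A * (c + 1 - subharmonicExhaustion Y y)) (⨍ t in closedBall y ε, g t)
    with h | h
  · rw [min_eq_right h]
    refine hle_p.trans (mul_le_mul_of_nonneg_left ?_ hA)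
    linarith [subharmonicExhaustion_le_setAverage hY hr hB]
  · rw [min_eq_left h.le]
    by_cases hBL : closedBall y r ⊆ L
    · exact hle_q.trans (setAverage_setAverage_le hg hgA hr hε (hmean y r hr hBL))
    · have hlow := (setAverage_closedBall_mem_Icc hg hgA y hε).1
      have hsy : subharmonicExhaustion Y y < c + 2 := by
        by_contra! hcon
        nlinarith
      have := hL y hsy r hr hB hBL
      nlinarith

/-- The Jensen inequality for the truncations of a superharmonic function. -/
lemma SuperharmonicOn.integral_truncation_le [NeZero d] (hY : IsOpen Y)
    {x : EuclideanSpace ℝ (Fin d)} (hx : x ∈ Y)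
    (μ : Measure (EuclideanSpace ℝ (Fin d))) [IsFiniteMeasure μ]
    {K : Set (EuclideanSpace ℝ (Fin d))} (hK : IsCompact K) (hKY : K ⊆ Y) (hμK : μ Kᶜ = 0)
    (hJensen : ∀ u : EuclideanSpace ℝ (Fin d) → ℝ, ContinuousOn u Y →
      SuperharmonicOn (fun y => (u y : EReal)) Y → ∫ y, u y ∂μ ≤ u x)
    {u : EuclideanSpace ℝ (Fin d) → EReal} (hu : SuperharmonicOn u Y) (n : ℕ) :
    ((∫ y, ((u y) ⊓ (n : EReal)).toReal ∂μ : ℝ) : EReal) ≤ u x := by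
  have hscont := continuousOn_subharmonicExhaustion hY
  have hK₁Y : insert x K ⊆ Y := insert_subset hx hKY
  obtain ⟨c, hc⟩ := (hK.insert x).bddAbove_image (hscont.mono hK₁Y)
  replace hc : ∀ w ∈ insert x K, subharmonicExhaustion Y w ≤ c := fun w hw =>
    hc (mem_image_of_mem _ hw)
  obtain ⟨L, hLc, hLY, hLout, hL⟩ :=
    exists_compact_le_setAverage_subharmonicExhaustion hY (c + 2)
  have hK₁L : insert x K ⊆ L := fun w hw => by
    by_contra hwL
    linarith [hLout w (hK₁Y hw) hwL, hc w hw]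
  obtain ⟨δ, hδ, hKY'⟩ := hLc.exists_cthickening_subset_open hY hLY
  have hK'c : IsCompact (cthickening δ L) := hLc.cthickening
  obtain ⟨m, hm0, hm⟩ := hu.exists_forall_neg_le hK'c hKY'
  set g := truncation u (cthickening δ L) n with hgdef
  have hg : Measurable g := hu.measurable_truncation n hK'c.isClosed hKY'
  have hn : (0 : ℝ) ≤ n := n.cast_nonneg
  have hgA : ∀ w, g w ∈ Icc (-(m + n)) (m + n) := fun w =>
    Icc_subset_Icc (by linarith) (by linarith) (hu.truncation_mem_Icc n hKY' hm0 hm w)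
  have hballs : ∀ y, ∀ r > 0, ∀ ε ≤ δ, closedBall y r ⊆ L → ∀ v ∈ closedBall y ε,
      closedBall v r ⊆ cthickening δ L := by
    intro y r hr ε hε hBL v hv t ht
    refine mem_cthickening_of_dist_le t (t - (v - y)) δ L (hBL ?_) ?_
    · rw [mem_closedBall, dist_eq_norm] at ht ⊢
      rwa [show t - (v - y) - y = t - v by abel]
    · rw [dist_eq_norm, sub_sub_cancel, ← dist_eq_norm]
      exact (mem_closedBall.1 hv).trans hε
  have hballs' : ∀ y ∈ L, ∀ ε ≤ δ, closedBall y ε ⊆ cthickening δ L := fun y hy ε hε =>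
    (closedBall_subset_closedBall hε).trans (closedBall_subset_cthickening hy δ)
  have hstep : ∀ ε > 0, ε ≤ δ → ∫ y, ⨍ t in closedBall y ε, g t ∂volume ∂μ
      ≤ ⨍ t in closedBall x ε, g t := by
    intro ε hε hεδ
    set v : EuclideanSpace ℝ (Fin d) → ℝ := fun w =>
      min (⨍ t in closedBall w ε, g t) ((m + n) * (c + 1 - subharmonicExhaustion Y w)) with hvdef
    have hv : ContinuousOn v Y :=
      (continuous_setAverage_closedBall hg hgA ε).continuousOn.inf (by fun_prop)
    have hvK : ∀ w ∈ insert x K, v w = ⨍ t in closedBall w ε, g t := fun w hw => by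
      refine min_eq_left ?_
      have := (setAverage_closedBall_mem_Icc hg hgA w hε).2
      nlinarith [hc w hw]
    have h := hJensen v hv (superharmonicOn_coe hv fun y _ r hr hB =>
      setAverage_min_barrier_le hY hg (by positivity) hgA hε hL
        (fun y r hr hBL w hw => hu.setAverage_truncation_le n hK'c hKY' hr
          (hballs y r hr ε hεδ hBL w hw)) hr hB)
    rw [hvK x (mem_insert _ _)] at h
    refine le_trans (integral_congr_ae ?_).le h
    filter_upwards [measure_eq_zero_iff_ae_notMem.1 hμK] with w hw
    exact (hvK w (mem_insert_of_mem _ (not_not.1 hw))).symm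
  set ε : ℕ → ℝ := fun k => δ / (k + 1) with hεdef
  have hεpos : ∀ k, 0 < ε k := fun k => by positivity
  have hεδ : ∀ k, ε k ≤ δ := fun k => div_le_self hδ.le (by linarith [k.cast_nonneg (α := ℝ)])
  have hεlim : Tendsto ε atTop (𝓝 0) := by
    simpa [hεdef, div_eq_mul_inv] using
      (tendsto_one_div_add_atTop_nhds_zero_nat (𝕜 := ℝ)).const_mul δ
  have hlim : ∀ y ∈ L, Tendsto (fun k => ⨍ t in closedBall y (ε k), g t) atTop (𝓝 (g y)) :=
    fun y hy => tendsto_setAverage_closedBall hg hgA hεpos hεlim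
      (fun k => hu.setAverage_truncation_le n hK'c hKY' (hεpos k) (hballs' y hy _ (hεδ k)))
      (hu.lowerSemicontinuousAt_truncation n hKY'
        (mem_of_superset (closedBall_mem_nhds y hδ) (hballs' y hy δ le_rfl)))
  have hint : Tendsto (fun k => ∫ y, ⨍ t in closedBall y (ε k), g t ∂volume ∂μ) atTop
      (𝓝 (∫ y, g y ∂μ)) := by
    refine tendsto_integral_of_dominated_convergence (fun _ => m + n)
      (fun k => (continuous_setAverage_closedBall hg hgA _).aestronglyMeasurable)
      (integrable_const _) (fun k => Eventually.of_forall fun w => ?_) ?_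
    · exact abs_le.2 (setAverage_closedBall_mem_Icc hg hgA w (hεpos k))
    · filter_upwards [measure_eq_zero_iff_ae_notMem.1 hμK] with w hw
      exact hlim w (hK₁L (mem_insert_of_mem _ (not_not.1 hw)))
  have hLK' : L ⊆ cthickening δ L := self_subset_cthickening L
  have hxL : x ∈ L := hK₁L (mem_insert _ _)
  have hfinal : ∫ y, g y ∂μ ≤ g x :=
    le_of_tendsto_of_tendsto' hint (hlim x hxL) fun k => hstep _ (hεpos k) (hεδ k)
  have hcongr : ∫ y, ((u y) ⊓ (n : EReal)).toReal ∂μ = ∫ y, g y ∂μ := by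
    refine integral_congr_ae ?_
    filter_upwards [measure_eq_zero_iff_ae_notMem.1 hμK] with w hw
    rw [hgdef, truncation,
      indicator_of_mem (hLK' (hK₁L (mem_insert_of_mem _ (not_not.1 hw))))]
  rw [hcongr]
  refine (EReal.coe_le_coe_iff.2 hfinal).trans ?_
  rw [hu.coe_truncation n hKY' (hLK' hxL)]
  exact inf_le_left

lemma SuperharmonicOn.lintegral_neg_lt_top {μ : Measure (EuclideanSpace ℝ (Fin d))}
    [IsFiniteMeasure μ] {K : Set (EuclideanSpace ℝ (Fin d))} (hK : IsCompact K) (hKY : K ⊆ Y)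
    (hμK : μ Kᶜ = 0) {u : EuclideanSpace ℝ (Fin d) → EReal} (hu : SuperharmonicOn u Y) :
    ∫⁻ y, ENNReal.ofReal ((-(u y)).toReal) ∂μ < ⊤ := by
  obtain ⟨m, hm0, hm⟩ := hu.exists_forall_neg_le hK hKY
  refine (lintegral_mono_ae (g := fun _ => ENNReal.ofReal m) ?_).trans_lt ?_
  · filter_upwards [measure_eq_zero_iff_ae_notMem.1 hμK] with w hw
    have hmw := hm w (not_not.1 hw)
    refine ENNReal.ofReal_le_ofReal ?_
    generalize u w = t at hmw
    induction t with
    | bot => simp at hmw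
    | top => simpa using hm0
    | coe t =>
      rw [EReal.coe_le_coe_iff] at hmw
      rw [← EReal.coe_neg, EReal.toReal_coe]
      linarith
  · rw [lintegral_const]
    exact ENNReal.mul_lt_top ENNReal.ofReal_lt_top (measure_lt_top μ _)

end Barrier

/-- If `μ` is a compactly supported finite measure on an open set `Y ⊆ ℝ^d`
(`d ≥ 2`) with `∫ u dμ ≤ u x` for every continuous superharmonic `u` on `Y`, then for
every superharmonic `u` on `Y` the negative part of `u` is `μ`-integrable and
`∫ u dμ ≤ u x` (expressed via the increasing truncations `u ⊓ n`). -/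
theorem stmt_5 {d : ℕ} (hd : 2 ≤ d) {Y : Set (EuclideanSpace ℝ (Fin d))} (hY : IsOpen Y)
    {x : EuclideanSpace ℝ (Fin d)} (hx : x ∈ Y)
    (μ : Measure (EuclideanSpace ℝ (Fin d))) [IsFiniteMeasure μ]
    (hsupp : ∃ K, IsCompact K ∧ K ⊆ Y ∧ μ Kᶜ = 0)
    (hJensen : ∀ u : EuclideanSpace ℝ (Fin d) → ℝ, ContinuousOn u Y →
      SuperharmonicOn (fun y => (u y : EReal)) Y → ∫ y, u y ∂μ ≤ u x) :
    ∀ u : EuclideanSpace ℝ (Fin d) → EReal, SuperharmonicOn u Y →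
      (∫⁻ y, ENNReal.ofReal ((-(u y)).toReal) ∂μ < ⊤) ∧
      ∀ n : ℕ, ((∫ y, ((u y) ⊓ (n : EReal)).toReal ∂μ : ℝ) : EReal) ≤ u x := by
  intro u hu
  have : NeZero d := ⟨by omega⟩
  obtain ⟨K, hK, hKY, hμK⟩ := hsupp
  exact ⟨hu.lintegral_neg_lt_top hK hKY hμK,
    hu.integral_truncation_le hY hx μ hK hKY hμK hJensen⟩
end

section
/- Let Y ⊆ ℝ^d be a bounded open set (d ≥ 2), C a connected component of ∂Y, and U a connected open neighborhood of C in ℝ^d with U ∩ ∂Y polar. Then U \ ∂Y is connected and equals U ∩ Y ∪ (U \ Ȳ); moreover if U ∩ Y ≠ ∅ then U \ ∂Y = U ∩ Y, i.e. U ⊆ Ȳ. -/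
open MeasureTheory Metric

/-- `P ⊆ ℝ^d` is polar if some superharmonic function on an open neighborhood of `P`
equals `+∞` on `P`. -/
def IsPolar {d : ℕ} (P : Set (EuclideanSpace ℝ (Fin d))) : Prop :=
  ∃ (V : Set (EuclideanSpace ℝ (Fin d))) (u : EuclideanSpace ℝ (Fin d) → EReal),
    IsOpen V ∧ P ⊆ V ∧ SuperharmonicOn u V ∧ ∀ x ∈ P, u x = ⊤

open scoped Topology

theorem exp_neg_mul_norm_add_sq_add_ge {E : Type*} [NormedAddCommGroup E]
    [InnerProductSpace ℝ E] {α : ℝ} (e z : E) (hz : α * ‖z‖ ^ 2 ≤ 1 / 2) :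
    Real.exp (-α * ‖e‖ ^ 2) * (2 - 2 * α * ‖z‖ ^ 2 + α ^ 2 * inner ℝ e z ^ 2) ≤
      Real.exp (-α * ‖e + z‖ ^ 2) + Real.exp (-α * ‖e + -z‖ ^ 2) := by
  have hcosh (t : ℝ) : 2 + t ^ 2 / 2 ≤ Real.exp t + Real.exp (-t) := by
    rcases le_total 0 t with ht | ht
    · linarith [Real.quadratic_le_exp_of_nonneg ht, Real.add_one_le_exp (-t)]
    · have := Real.quadratic_le_exp_of_nonneg (neg_nonneg.2 ht)
      nlinarith [Real.add_one_le_exp t]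
  have h₁ : Real.exp (-α * ‖e + z‖ ^ 2) = Real.exp (-α * ‖e‖ ^ 2) *
      (Real.exp (-(α * ‖z‖ ^ 2)) * Real.exp (-(2 * α * inner ℝ e z))) := by
    rw [← Real.exp_add, ← Real.exp_add, norm_add_sq_real]
    ring_nf
  have h₂ : Real.exp (-α * ‖e + -z‖ ^ 2) = Real.exp (-α * ‖e‖ ^ 2) *
      (Real.exp (-(α * ‖z‖ ^ 2)) * Real.exp (2 * α * inner ℝ e z)) := by
    rw [← Real.exp_add, ← Real.exp_add, norm_add_sq_real, inner_neg_right, norm_neg]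
    ring_nf
  rw [h₁, h₂, ← mul_add, ← mul_add]
  refine mul_le_mul_of_nonneg_left ?_ (Real.exp_pos _).le
  have h₃ := Real.one_sub_le_exp_neg (α * ‖z‖ ^ 2)
  have h₄ := hcosh (2 * α * inner ℝ e z)
  have h₅ := mul_le_mul h₃ h₄ (by positivity) (Real.exp_pos _).le
  nlinarith [mul_nonneg (sub_nonneg.2 hz) (sq_nonneg (α * inner ℝ e z))]

theorem integrableOn_closedBall_of_continuous {X : Type*} [MetricSpace X] [ProperSpace X]
    [MeasurableSpace X] [OpensMeasurableSpace X] {μ : Measure X} [IsFiniteMeasureOnCompacts μ]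
    {x : X} {r : ℝ} {f : X → ℝ} (hf : Continuous f) : IntegrableOn f (closedBall x r) μ :=
  hf.continuousOn.integrableOn_compact (isCompact_closedBall x r)

section GaussianBarrier

variable {E : Type*} [NormedAddCommGroup E] [InnerProductSpace ℝ E] [FiniteDimensional ℝ E]
  [MeasurableSpace E] [BorelSpace E]

theorem setIntegral_closedBall_zero_comp_linearIsometryEquiv (T : E ≃ₗᵢ[ℝ] E) (f : E → ℝ) (r : ℝ) :
    ∫ z in closedBall (0 : E) r, f (T z) = ∫ z in closedBall (0 : E) r, f z := by
  have h := T.measurePreserving.setIntegral_preimage_emb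
    T.toHomeomorph.measurableEmbedding f (closedBall 0 r)
  rwa [T.preimage_closedBall, map_zero] at h

theorem setIntegral_inner_sq_closedBall_zero (e : E) (r : ℝ) :
    (Module.finrank ℝ E : ℝ) * ∫ z in closedBall (0 : E) r, inner ℝ e z ^ 2 =
      ‖e‖ ^ 2 * ∫ z in closedBall (0 : E) r, ‖z‖ ^ 2 := by
  let b := stdOrthonormalBasis ℝ E
  have hsymm (i : Fin (Module.finrank ℝ E)) : ∫ z in closedBall (0 : E) r, inner ℝ e z ^ 2 =
      ‖e‖ ^ 2 * ∫ z in closedBall (0 : E) r, ‖inner ℝ (b i) z‖ ^ 2 := by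
    have hnorm : ‖e‖ = ‖‖e‖ • b i‖ := by simp [norm_smul]
    rw [← setIntegral_closedBall_zero_comp_linearIsometryEquiv
      (Submodule.reflection (Submodule.span ℝ {‖e‖ • b i - e})ᗮ), ← integral_const_mul]
    congr 1 with z
    have h : inner ℝ e (Submodule.reflection (Submodule.span ℝ {‖e‖ • b i - e})ᗮ z) =
        ‖e‖ * inner ℝ (b i) z := by
      have hmap := LinearIsometryEquiv.inner_map_map
        (Submodule.reflection (Submodule.span ℝ {‖e‖ • b i - e})ᗮ) (‖e‖ • b i) z
      rwa [Submodule.reflection_sub hnorm.symm, real_inner_smul_left] at hmap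
    rw [h, Real.norm_eq_abs, sq_abs, mul_pow]
  have hsum : ∫ z in closedBall (0 : E) r, ‖z‖ ^ 2 =
      ∑ i, ∫ z in closedBall (0 : E) r, ‖inner ℝ (b i) z‖ ^ 2 := by
    rw [← integral_finsetSum]
    · simp_rw [b.sum_sq_norm_inner_right]
    · intro i _
      exact integrableOn_closedBall_of_continuous (by fun_prop)
  rw [hsum, Finset.mul_sum, ← Finset.sum_congr rfl fun i _ => hsymm i]
  simp

theorem setIntegral_norm_sq_closedBall_zero_pos [Nontrivial E] {r : ℝ} (hr : 0 < r) :
    0 < ∫ z in closedBall (0 : E) r, ‖z‖ ^ 2 := by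
  rw [setIntegral_pos_iff_support_of_nonneg_ae
    (Filter.Eventually.of_forall fun z => by positivity)
    (integrableOn_closedBall_of_continuous (by fun_prop))]
  have hsupp : Function.support (fun z : E => ‖z‖ ^ 2) = {0}ᶜ := by
    ext z; simp
  rw [hsupp, ← Set.sdiff_eq_compl_inter, measure_sdiff_null (measure_singleton _)]
  exact measure_closedBall_pos _ _ hr

/-- The Gaussian `exp (-α ‖y - a‖²)` is strictly subharmonic away from `a` if `α` is large. -/
theorem mul_exp_lt_setIntegral_closedBall {α r : ℝ} (hα : 0 < α) (hr : 0 < r) (a x : E)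
    (hαx : 2 * Module.finrank ℝ E < α * ‖x - a‖ ^ 2) (hαr : α * r ^ 2 ≤ 1 / 2) :
    volume.real (closedBall x r) * Real.exp (-α * ‖x - a‖ ^ 2) <
      ∫ y in closedBall x r, Real.exp (-α * ‖y - a‖ ^ 2) := by
  set e := x - a
  have he : e ≠ 0 := by
    rintro he
    rw [he] at hαx
    simp only [norm_zero] at hαx
    have : (0 : ℝ) ≤ Module.finrank ℝ E := by positivity
    linarith
  have : Nontrivial E := ⟨⟨e, 0, he⟩⟩
  have hd : (0 : ℝ) < Module.finrank ℝ E := by exact_mod_cast Module.finrank_pos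
  have htrans : ∫ y in closedBall x r, Real.exp (-α * ‖y - a‖ ^ 2) =
      ∫ z in closedBall (0 : E) r, Real.exp (-α * ‖e + z‖ ^ 2) := by
    have h := (measurePreserving_add_left (volume : Measure E) x).setIntegral_preimage_emb
      (measurableEmbedding_addLeft x) (fun y => Real.exp (-α * ‖y - a‖ ^ 2)) (closedBall x r)
    rw [preimage_add_closedBall, sub_self] at h
    rw [← h]
    congr 1 with z
    rw [add_sub_right_comm]
  have hneg := setIntegral_closedBall_zero_comp_linearIsometryEquiv
    (LinearIsometryEquiv.neg ℝ) (fun z : E => Real.exp (-α * ‖e + z‖ ^ 2)) r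
  simp only [LinearIsometryEquiv.coe_neg] at hneg
  have hint₁ : IntegrableOn (fun z : E => Real.exp (-α * ‖e + z‖ ^ 2)) (closedBall 0 r) :=
    integrableOn_closedBall_of_continuous (by fun_prop)
  have hint₂ : IntegrableOn (fun z : E => Real.exp (-α * ‖e + -z‖ ^ 2)) (closedBall 0 r) :=
    integrableOn_closedBall_of_continuous (by fun_prop)
  have hint₃ : IntegrableOn (fun z : E => α ^ 2 * inner ℝ e z ^ 2) (closedBall 0 r) :=
    integrableOn_closedBall_of_continuous (by fun_prop)
  have hint₄ : IntegrableOn (fun z : E => 2 * α * ‖z‖ ^ 2) (closedBall 0 r) :=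
    integrableOn_closedBall_of_continuous (by fun_prop)
  have hint₅ : IntegrableOn (fun z : E => 2 - 2 * α * ‖z‖ ^ 2) (closedBall 0 r) :=
    integrableOn_closedBall_of_continuous (by fun_prop)
  have hint₆ : IntegrableOn (fun _ : E => (2 : ℝ)) (closedBall 0 r) :=
    integrableOn_closedBall_of_continuous (by fun_prop)
  have hmono := setIntegral_mono_on
    (integrableOn_closedBall_of_continuous (μ := volume) (x := (0 : E)) (r := r)
      (f := fun z => Real.exp (-α * ‖e‖ ^ 2) *
        (2 - 2 * α * ‖z‖ ^ 2 + α ^ 2 * inner ℝ e z ^ 2)) (by fun_prop))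
    (hint₁.add hint₂) measurableSet_closedBall (fun z hz => by
      refine exp_neg_mul_norm_add_sq_add_ge e z (le_trans ?_ hαr)
      have : ‖z‖ ≤ r := by simpa using hz
      gcongr)
  rw [integral_const_mul, integral_add hint₅ hint₃, integral_sub hint₆ hint₄,
    setIntegral_const, integral_const_mul, integral_const_mul] at hmono
  simp only [Pi.add_apply] at hmono
  rw [integral_add hint₁ hint₂, hneg, ← htrans, smul_eq_mul] at hmono
  have hvol : volume.real (closedBall x r) = volume.real (closedBall (0 : E) r) := by
    simp [Measure.real, Measure.addHaar_closedBall_center]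
  rw [hvol]
  have hpos := setIntegral_norm_sq_closedBall_zero_pos (E := E) hr
  have hkey := setIntegral_inner_sq_closedBall_zero e r
  set I := ∫ z in closedBall (0 : E) r, ‖z‖ ^ 2
  set J := ∫ z in closedBall (0 : E) r, inner ℝ e z ^ 2
  have hJ : 2 * α * I < α ^ 2 * J := by
    refine lt_of_mul_lt_mul_left (a := (Module.finrank ℝ E : ℝ)) ?_ hd.le
    nlinarith [mul_lt_mul_of_pos_right hαx (mul_pos hα hpos)]
  nlinarith [mul_pos (Real.exp_pos (-α * ‖e‖ ^ 2)) (sub_pos.2 hJ)]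

end GaussianBarrier

theorem EReal.lt_toReal_inf_natCast_iff {x : EReal} (hx : ⊥ < x) {n : ℕ} {y : ℝ} :
    y < (x ⊓ (n : EReal)).toReal ↔ (y : EReal) < x ∧ y < n := by
  have hn : ((n : ℝ) : EReal) = (n : EReal) := rfl
  have h : (((x ⊓ (n : EReal)).toReal : ℝ) : EReal) = x ⊓ (n : EReal) := by
    refine EReal.coe_toReal ?_ ?_
    · exact ne_top_of_le_ne_top (EReal.natCast_ne_top n) inf_le_right
    · rw [← bot_lt_iff_ne_bot]
      exact lt_inf_iff.2 ⟨hx, hn ▸ EReal.bot_lt_coe _⟩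
  rw [← EReal.coe_lt_coe_iff, h, lt_inf_iff, ← hn, EReal.coe_lt_coe_iff]

theorem LowerSemicontinuousOn.toReal_inf_natCast {X : Type*} [TopologicalSpace X] {v : X → EReal}
    {K : Set X} (hv : LowerSemicontinuousOn v K) (hbot : ∀ x ∈ K, ⊥ < v x) (n : ℕ) :
    LowerSemicontinuousOn (fun x => (v x ⊓ (n : EReal)).toReal) K := by
  intro x hx y hy
  replace hy := (EReal.lt_toReal_inf_natCast_iff (hbot x hx)).1 hy
  filter_upwards [hv x hx y hy.1, self_mem_nhdsWithin] with z hz hzK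
  exact (EReal.lt_toReal_inf_natCast_iff (hbot z hzK)).2 ⟨hz, hy.2⟩

theorem LowerSemicontinuousOn.aemeasurable_restrict {X : Type*} [TopologicalSpace X]
    [MeasurableSpace X] [BorelSpace X] {μ : Measure X} {f : X → ℝ} {K : Set X}
    (hf : LowerSemicontinuousOn f K) (hK : MeasurableSet K) : AEMeasurable f (μ.restrict K) := by
  rw [aemeasurable_restrict_iff_comap_subtype hK]
  exact (lowerSemicontinuous_restrict_iff.2 hf).measurable.aemeasurable

theorem LowerSemicontinuousOn.exists_real_le {X : Type*} [TopologicalSpace X] {v : X → EReal}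
    {K : Set X} (hv : LowerSemicontinuousOn v K) (hK : IsCompact K) (hbot : ∀ x ∈ K, ⊥ < v x) :
    ∃ m : ℝ, ∀ x ∈ K, (m : EReal) ≤ v x := by
  rcases K.eq_empty_or_nonempty with rfl | hne
  · simp
  obtain ⟨x₀, hx₀, hmin⟩ := hv.exists_isMinOn hne hK
  obtain ⟨m, -, hm⟩ := EReal.lt_iff_exists_real_btwn.1 (hbot x₀ hx₀)
  exact ⟨m, fun x hx => hm.le.trans (hmin hx)⟩

section Barrier

variable {d : ℕ} {v : EuclideanSpace ℝ (Fin d) → EReal}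

/-- If `v` is infinite on a ball and satisfies the super-mean-value inequality for small radii at
the points of a larger concentric ball where it is finite, then it is infinite on the larger ball.
This is a comparison with large multiples of Hopf's barrier `exp (-α ‖x - a‖²)`. -/
theorem eq_top_of_eq_top_on_smaller_ball {a : EuclideanSpace ℝ (Fin d)} {ρ R : ℝ} (hρ : 0 < ρ)
    (hlsc : LowerSemicontinuousOn v (closedBall a R)) (hbot : ∀ x ∈ closedBall a R, ⊥ < v x)
    (htop : ∀ x ∈ closedBall a ρ, v x = ⊤)
    (hmean : ∀ x ∈ ball a R, v x ≠ ⊤ → ∀ᶠ r in 𝓝[>] (0 : ℝ), ∀ n : ℕ,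
      ((⨍ y in closedBall x r, ((v y) ⊓ (n : EReal)).toReal ∂volume : ℝ) : EReal) ≤ v x)
    {x₁ : EuclideanSpace ℝ (Fin d)} (hx₁ : x₁ ∈ ball a R) : v x₁ = ⊤ := by
  by_contra hx₁top
  obtain ⟨m, hm⟩ := hlsc.exists_real_le (isCompact_closedBall a R) hbot
  obtain ⟨α, hα⟩ : ∃ α : ℝ, 2 * d < α * ρ ^ 2 := by
    refine ⟨(2 * d + 1) / ρ ^ 2, ?_⟩
    field_simp
    linarith
  have hα₀ : 0 < α := by
    have : (0 : ℝ) ≤ 2 * d := by positivity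
    exact pos_of_mul_pos_left (this.trans_lt hα) (by positivity)
  set g : EuclideanSpace ℝ (Fin d) → ℝ := fun x => Real.exp (-α * ‖x - a‖ ^ 2) with hg
  have hgcont : Continuous g := by fun_prop
  set c : ℝ := Real.exp (-α * R ^ 2) with hc
  have hR : 0 < R := pos_of_mem_ball hx₁
  have hgc : c < g x₁ := by
    have : ‖x₁ - a‖ < R := mem_ball_iff_norm.1 hx₁
    apply Real.exp_lt_exp.2
    nlinarith [norm_nonneg (x₁ - a), pow_lt_pow_left₀ this (norm_nonneg _) two_ne_zero]
  have hg1 (x) : g x ≤ 1 := by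
    apply Real.exp_le_one_iff.2
    nlinarith [sq_nonneg ‖x - a‖]
  obtain ⟨t, ht⟩ : ∃ t : ℝ, v x₁ = t :=
    ⟨_, (EReal.coe_toReal hx₁top (hbot x₁ (ball_subset_closedBall hx₁)).ne').symm⟩
  obtain ⟨N, hN₀, hN⟩ : ∃ N : ℝ, 0 < N ∧ t < m + N * (g x₁ - c) := by
    refine ⟨(|t - m| + 1) / (g x₁ - c), div_pos (by positivity) (sub_pos.2 hgc), ?_⟩
    rw [div_mul_cancel₀ _ (sub_pos.2 hgc).ne']
    linarith [le_abs_self (t - m)]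
  obtain ⟨M, hM⟩ := exists_nat_gt (max m (m + N))
  have hMm : m < M := (le_max_left _ _).trans_lt hM
  have hMN : m + N < M := (le_max_right _ _).trans_lt hM
  set w : EuclideanSpace ℝ (Fin d) → ℝ := fun x => (v x ⊓ (M : EReal)).toReal with hw
  have hwlsc : LowerSemicontinuousOn w (closedBall a R) := hlsc.toReal_inf_natCast hbot M
  have hwlt {x} (hx : x ∈ closedBall a R) (y : ℝ) : y < w x ↔ (y : EReal) < v x ∧ y < M :=
    EReal.lt_toReal_inf_natCast_iff (hbot x hx)
  have hwm {x} (hx : x ∈ closedBall a R) : m ≤ w x := by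
    refine le_of_forall_lt fun y hy => (hwlt hx y).2 ⟨?_, hy.trans hMm⟩
    exact (EReal.coe_lt_coe_iff.2 hy).trans_le (hm x hx)
  have hwM {x} (hx : x ∈ closedBall a R) : w x ≤ M :=
    le_of_forall_lt fun y hy => ((hwlt hx y).1 hy).2
  have hwv {x} (hx : x ∈ closedBall a R) (hlt : w x < M) : v x ≤ w x := by
    by_contra! h
    obtain ⟨q, hwq, hqv⟩ := EReal.lt_iff_exists_real_btwn.1 h
    rw [EReal.coe_lt_coe_iff] at hwq
    obtain ⟨y, hwy, hy⟩ := exists_between (lt_min hwq hlt)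
    rw [lt_min_iff] at hy
    exact hwy.not_gt ((hwlt hx y).2 ⟨(EReal.coe_lt_coe_iff.2 hy.1).trans hqv, hy.2⟩)
  have hflsc : LowerSemicontinuousOn (fun x => w x + -(N * g x)) (closedBall a R) :=
    hwlsc.add (by fun_prop : Continuous fun x => -(N * g x)).continuousOn.lowerSemicontinuousOn
  obtain ⟨x₀, hx₀, hmin⟩ := hflsc.exists_isMinOn ⟨x₁, ball_subset_closedBall hx₁⟩
    (isCompact_closedBall a R)
  replace hmin {x} (hx : x ∈ closedBall a R) : w x₀ + -(N * g x₀) ≤ w x + -(N * g x) := hmin hx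
  have hx₀lt : w x₀ - N * g x₀ < m - N * c := by
    have h₁ : w x₁ ≤ t := by
      refine le_of_forall_lt fun y hy => ?_
      simpa [ht] using ((hwlt (ball_subset_closedBall hx₁) y).1 hy).1
    have h₂ := hmin (ball_subset_closedBall hx₁)
    linarith
  have hc₀ : 0 < c := Real.exp_pos _
  have hwx₀ : w x₀ < M := by nlinarith [hg1 x₀, mul_pos hN₀ hc₀]
  have hvx₀ := hwv hx₀ hwx₀
  have hvtop : v x₀ ≠ ⊤ := ne_top_of_le_ne_top (EReal.coe_ne_top _) hvx₀
  have hx₀ρ : ρ < ‖x₀ - a‖ := by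
    by_contra! h
    exact hvtop (htop x₀ (mem_closedBall_iff_norm.2 h))
  have hx₀R : x₀ ∈ ball a R := by
    rw [mem_ball_iff_norm]
    refine lt_of_le_of_ne (mem_closedBall_iff_norm.1 hx₀) fun h => ?_
    have : g x₀ = c := by simp only [hg, hc, h]
    rw [this] at hx₀lt
    linarith [hwm hx₀]
  have hsmall : ∀ᶠ r in 𝓝[>] (0 : ℝ), closedBall x₀ r ⊆ closedBall a R := by
    filter_upwards [nhdsWithin_le_nhds (eventually_closedBall_subset (isOpen_ball.mem_nhds hx₀R))]
      with r hr using hr.trans ball_subset_closedBall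
  have hαr : ∀ᶠ r in 𝓝[>] (0 : ℝ), α * r ^ 2 ≤ 1 / 2 := by
    have h : Filter.Tendsto (fun r : ℝ => α * r ^ 2) (𝓝 0) (𝓝 (α * 0 ^ 2)) :=
      (by fun_prop : Continuous fun r : ℝ => α * r ^ 2).tendsto 0
    exact nhdsWithin_le_nhds (h.eventually_le_const (by norm_num))
  obtain ⟨r, hmeanr, hsub, hαr, hr⟩ := ((hmean x₀ hx₀R hvtop).and
    (hsmall.and (hαr.and self_mem_nhdsWithin))).exists
  have hr : 0 < r := hr
  have hvol : 0 < volume.real (closedBall x₀ r) :=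
    ENNReal.toReal_pos (measure_closedBall_pos _ _ hr).ne' measure_closedBall_lt_top.ne
  have hwint : IntegrableOn w (closedBall x₀ r) := by
    have : IsFiniteMeasure (volume.restrict (closedBall x₀ r)) :=
      ⟨by simpa using measure_closedBall_lt_top⟩
    refine Integrable.of_bound (C := max |m| |(M : ℝ)|)
      ((hwlsc.mono hsub).aemeasurable_restrict
        measurableSet_closedBall).aestronglyMeasurable ?_
    filter_upwards [ae_restrict_mem measurableSet_closedBall] with x hx
    exact abs_le_max_abs_abs (hwm (hsub hx)) (hwM (hsub hx))
  have hw_le : ∫ y in closedBall x₀ r, w y ≤ volume.real (closedBall x₀ r) * w x₀ := by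
    have h := EReal.coe_le_coe_iff.1 ((hmeanr M).trans hvx₀)
    rw [setAverage_eq, smul_eq_mul, inv_mul_le_iff₀ hvol] at h
    exact h
  have hg_lt : volume.real (closedBall x₀ r) * g x₀ < ∫ y in closedBall x₀ r, g y := by
    refine mul_exp_lt_setIntegral_closedBall hα₀ hr a x₀ ?_ hαr
    rw [finrank_euclideanSpace_fin]
    exact hα.trans_le (by gcongr)
  have hgint : IntegrableOn g (closedBall x₀ r) := integrableOn_closedBall_of_continuous hgcont
  have hmono : ∫ y in closedBall x₀ r, ((w x₀ - N * g x₀) + N * g y) ≤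
      ∫ y in closedBall x₀ r, w y := by
    refine setIntegral_mono_on (integrableOn_closedBall_of_continuous (by fun_prop)) hwint
      measurableSet_closedBall fun x hx => ?_
    linarith [hmin (hsub hx)]
  rw [integral_add (integrableOn_closedBall_of_continuous (by fun_prop))
    (hgint.const_mul N), setIntegral_const, integral_const_mul, smul_eq_mul] at hmono
  nlinarith [mul_lt_mul_of_pos_left hg_lt hN₀]

end Barrier

section Superharmonic

variable {d : ℕ} {u : EuclideanSpace ℝ (Fin d) → EReal} {V : Set (EuclideanSpace ℝ (Fin d))}

theorem SuperharmonicOn.eventually_setAverage_le (hu : SuperharmonicOn u V) (hV : IsOpen V)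
    {x : EuclideanSpace ℝ (Fin d)} (hx : x ∈ V) : ∀ᶠ r in 𝓝[>] (0 : ℝ), ∀ n : ℕ,
      ((⨍ y in closedBall x r, ((u y) ⊓ (n : EReal)).toReal ∂volume : ℝ) : EReal) ≤ u x := by
  filter_upwards [nhdsWithin_le_nhds (eventually_closedBall_subset (hV.mem_nhds hx)),
    self_mem_nhdsWithin] with r hr hr₀
  exact hu.2.2.2 x hx r hr₀ hr

theorem SuperharmonicOn.exists_ne_top (hu : SuperharmonicOn u V) (hV : IsOpen V)
    {O : Set (EuclideanSpace ℝ (Fin d))} (hO : IsOpen O) (hne : O.Nonempty) (hOV : O ⊆ V) :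
    ∃ x ∈ O, u x ≠ ⊤ := by
  by_contra! htop
  obtain ⟨x₀, hx₀⟩ := hne
  set I := interior {x | u x = ⊤}
  have hOI : O ⊆ I := interior_maximal htop hO
  have hsub : connectedComponentIn V x₀ ⊆ I := by
    refine isPreconnected_connectedComponentIn.subset_of_closure_inter_subset isOpen_interior
      ⟨x₀, mem_connectedComponentIn (hOV hx₀), hOI hx₀⟩ ?_
    rintro x ⟨hxI, hxC⟩
    have hxV : x ∈ V := connectedComponentIn_subset _ _ hxC
    obtain ⟨ε, hε, hεV⟩ := Metric.isOpen_iff.1 hV x hxV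
    obtain ⟨a, haI, hxa⟩ := Metric.mem_closure_iff.1 hxI (ε / 3) (by positivity)
    have hKV : closedBall a (ε / 3) ⊆ V := by
      refine Set.Subset.trans (fun y hy => ?_) hεV
      rw [mem_closedBall] at hy
      rw [dist_comm] at hxa
      exact mem_ball.2 (by linarith [dist_triangle y a x])
    obtain ⟨ρ, hρ, hρI⟩ := Metric.nhds_basis_closedBall.mem_iff.1 (isOpen_interior.mem_nhds haI)
    have hball : ball a (ε / 3) ⊆ {x | u x = ⊤} := fun y hy =>
      eq_top_of_eq_top_on_smaller_ball hρ (hu.1.mono hKV) (fun z hz => hu.2.1 z (hKV hz))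
        (fun z hz => (interior_subset (hρI hz) : z ∈ {x | u x = ⊤}))
        (fun z hz _ => hu.eventually_setAverage_le hV (hKV (ball_subset_closedBall hz))) hy
    exact interior_maximal hball isOpen_ball (mem_ball.2 hxa)
  obtain ⟨y, hy, hyt⟩ := hu.2.2.1 x₀ (hOV hx₀)
  exact hyt (interior_subset (hsub hy) : y ∈ {x | u x = ⊤})

/-- A relatively closed polar subset does not disconnect a connected open set. -/
theorem IsPolar.isConnected_sdiff {U P : Set (EuclideanSpace ℝ (Fin d))} (hP : IsPolar P)
    (hU : IsOpen U) (hUconn : IsConnected U) (hD : IsOpen (U \ P)) :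
    IsConnected (U \ P) := by
  obtain ⟨V, u, hV, hPV, hu, htop⟩ := hP
  have hdense : U ⊆ closure (U \ P) := by
    intro x hx
    rw [_root_.mem_closure_iff]
    intro O hO hxO
    by_contra hempty
    have hOP : O ∩ U ⊆ P := fun y hy => by
      by_contra hyP
      exact hempty ⟨y, hy.1, hy.2, hyP⟩
    obtain ⟨y, hy, hyt⟩ := hu.exists_ne_top hV (hO.inter hU) ⟨x, hxO, hx⟩ (hOP.trans hPV)
    exact hyt (htop y (hOP hy))
  refine ⟨closure_nonempty_iff.1 (hUconn.nonempty.mono hdense), ?_⟩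
  intro A B hA hB hAB hneA hneB
  by_contra hdisj
  set A' := (U \ P) ∩ A
  set B' := (U \ P) ∩ B
  have hA' : IsOpen A' := hD.inter hA
  have hB' : IsOpen B' := hD.inter hB
  have hdisj' : Disjoint A' B' := Set.disjoint_left.2 fun x hxA hxB =>
    hdisj ⟨x, hxA.1, hxA.2, hxB.2⟩
  have hcover : U ⊆ closure A' ∪ closure B' := by
    rw [← closure_union, ← Set.inter_union_distrib_left, Set.inter_eq_left.2 hAB]
    exact hdense
  obtain ⟨p, hpU, hpA, hpB⟩ := isPreconnected_closed_iff.1 hUconn.isPreconnected _ _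
    isClosed_closure isClosed_closure hcover
    (hneA.mono fun x hx => ⟨hx.1.1, subset_closure hx⟩)
    (hneB.mono fun x hx => ⟨hx.1.1, subset_closure hx⟩)
  have hpP : p ∈ P := by
    by_contra hpP
    rcases hAB ⟨hpU, hpP⟩ with h | h
    · exact Set.disjoint_left.1 (hdisj'.closure_right hA') ⟨⟨hpU, hpP⟩, h⟩ hpB
    · exact Set.disjoint_left.1 (hdisj'.closure_left hB') hpA ⟨⟨hpU, hpP⟩, h⟩
  obtain ⟨ε, hε, hεUV⟩ := Metric.isOpen_iff.1 (hU.inter hV) p ⟨hpU, hPV hpP⟩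
  obtain ⟨a, haA, hpa⟩ := Metric.mem_closure_iff.1 hpA (ε / 3) (by positivity)
  have hK : closedBall a (ε / 3) ⊆ U ∩ V := by
    refine Set.Subset.trans (fun y hy => ?_) hεUV
    rw [mem_closedBall] at hy
    rw [dist_comm] at hpa
    exact mem_ball.2 (by linarith [dist_triangle y a p])
  obtain ⟨ρ, hρ, hρA⟩ := Metric.nhds_basis_closedBall.mem_iff.1 (hA'.mem_nhds haA)
  classical
  let v : EuclideanSpace ℝ (Fin d) → EReal := fun x => if x ∈ B' then u x else ⊤
  have huv (x) : u x ≤ v x := by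
    by_cases h : x ∈ B' <;> simp [v, h]
  have hlsc : LowerSemicontinuousOn v (closedBall a (ε / 3)) := by
    intro x hx y hy
    by_cases hxA : x ∈ A'
    · filter_upwards [nhdsWithin_le_nhds (hA'.mem_nhds hxA)] with z hz
      have h₁ (z) (hz : z ∈ A') : v z = ⊤ := if_neg (Set.disjoint_left.1 hdisj' hz)
      rwa [h₁ z hz, ← h₁ x hxA]
    · have hvx : v x = u x := by
        by_cases hxB : x ∈ B'
        · exact if_pos hxB
        · have hxP : x ∈ P := by
            by_contra hxP
            have hxD : x ∈ U \ P := ⟨(hK hx).1, hxP⟩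
            exact (hAB hxD).elim (fun h => hxA ⟨hxD, h⟩) (fun h => hxB ⟨hxD, h⟩)
          rw [htop x hxP]
          exact if_neg hxB
      rw [hvx] at hy
      filter_upwards [(hu.1.mono (hK.trans Set.inter_subset_right)) x hx y hy] with z hz
      exact hz.trans_le (huv z)
  obtain ⟨b, hbB, hb⟩ : ∃ b ∈ B', b ∈ ball a (ε / 3) := by
    obtain ⟨b, hb, hbB⟩ := _root_.mem_closure_iff.1 hpB (ball a (ε / 3)) isOpen_ball (mem_ball.2 hpa)
    exact ⟨b, hbB, hb⟩
  obtain ⟨y, ⟨hyB, hya⟩, hyt⟩ := hu.exists_ne_top hV (hB'.inter isOpen_ball) ⟨b, hbB, hb⟩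
    fun z hz => (hK (ball_subset_closedBall hz.2)).2
  refine hyt ?_
  rw [← show v y = u y from if_pos hyB]
  refine eq_top_of_eq_top_on_smaller_ball hρ hlsc
    (fun z hz => (hu.2.1 z (hK hz).2).trans_le (huv z))
    (fun z hz => if_neg (Set.disjoint_left.1 hdisj' (hρA hz))) (fun z hz hzt => ?_) hya
  have hzB : z ∈ B' := by
    by_contra h
    exact hzt (if_neg h)
  filter_upwards [hu.eventually_setAverage_le hV (hK (ball_subset_closedBall hz)).2,
    nhdsWithin_le_nhds (eventually_closedBall_subset (hB'.mem_nhds hzB))] with r hr hrB n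
  rw [show v z = u z from if_pos hzB]
  refine le_of_eq_of_le ?_ (hr n)
  rw [setAverage_congr_fun measurableSet_closedBall]
  filter_upwards with x hx
  rw [show v x = u x from if_pos (hrB hx)]

end Superharmonic

/-- Let `Y ⊆ ℝ^d` (`d ≥ 2`) be bounded open, `C` a connected component of
`∂Y`, and `U` a connected open neighborhood of `C` with `U ∩ ∂Y` polar. Then `U \ ∂Y` is
connected and equals `(U ∩ Y) ∪ (U \ closure Y)`; moreover, if `U ∩ Y ≠ ∅` then
`U \ ∂Y = U ∩ Y`, i.e. `U ⊆ closure Y`. -/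
theorem stmt_17 {d : ℕ} (hd : 2 ≤ d) {Y : Set (EuclideanSpace ℝ (Fin d))}
    (hY : IsOpen Y) (hbdd : Bornology.IsBounded Y)
    {c : EuclideanSpace ℝ (Fin d)} (hc : c ∈ frontier Y)
    {U : Set (EuclideanSpace ℝ (Fin d))} (hUopen : IsOpen U) (hUconn : IsConnected U)
    (hCU : connectedComponentIn (frontier Y) c ⊆ U)
    (hpolar : IsPolar (U ∩ frontier Y)) :
    IsConnected (U \ frontier Y) ∧
    U \ frontier Y = (U ∩ Y) ∪ (U \ closure Y) ∧
    ((U ∩ Y).Nonempty → U \ frontier Y = U ∩ Y ∧ U ⊆ closure Y) := by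
  have hsdiff : U \ (U ∩ frontier Y) = U \ frontier Y := Set.sdiff_self_inter
  have hconn : IsConnected (U \ frontier Y) := by
    have hD : IsOpen (U \ frontier Y) := hUopen.sdiff isClosed_frontier
    rw [← hsdiff] at hD ⊢
    exact hpolar.isConnected_sdiff hUopen hUconn hD
  have hunion : U \ frontier Y = (U ∩ Y) ∪ (U \ closure Y) := by
    ext x
    have hsub : x ∈ Y → x ∈ closure Y := fun h => subset_closure h
    simp only [hY.frontier_eq, Set.mem_sdiff, Set.mem_union, Set.mem_inter_iff]
    tauto
  refine ⟨hconn, hunion, fun hne => ?_⟩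
  have hsub : U \ frontier Y ⊆ Y := by
    refine hconn.isPreconnected.subset_of_closure_inter_subset hY ?_ ?_
    · exact hne.mono fun x hx => ⟨hunion ▸ Or.inl hx, hx.2⟩
    · rintro x ⟨hxY, hxU⟩
      rw [hunion] at hxU
      exact hxU.elim (fun h => h.2) fun h => absurd hxY h.2
  refine ⟨Set.Subset.antisymm (fun x hx => ⟨hx.1, hsub hx⟩) fun x hx => hunion ▸ Or.inl hx, ?_⟩
  intro x hx
  by_cases hxF : x ∈ frontier Y
  · exact frontier_subset_closure hxF
  · exact subset_closure (hsub ⟨hx, hxF⟩)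
end
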